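/- arXiv:2410.05240 — 10 statements merged into one kernel-verified Lean document; each statement's English description precedes it below -/
import Mathlib

section
/- Let G be a finite simple undirected graph with maximum degree Δ, let χ be a partial (Δ+1)-edge coloring of G, and let e₀ be an uncolored edge. Then there exists a partial (Δ+1)-edge coloring χ′ of G whose set of colored edges is exactly the set of edges colored by χ together with e₀ (i.e., the coloring can be extended to e₀, possibly recoloring other edges, without uncoloring any edge). -/
open Classical in
/-- In a connected component of a graph of maximum degree at most two, at most two vertices
have degree at most one. -/
theorem SimpleGraph.not_reachable_of_degree_le_one {V : Type*} [Fintype V] (H : SimpleGraph V)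
    (h2 : ∀ v, H.degree v ≤ 2) {a b c : V} (hab : a ≠ b) (hac : a ≠ c) (hbc : b ≠ c)
    (ha : H.degree a ≤ 1) (hb : H.degree b ≤ 1) (hc : H.degree c ≤ 1)
    (rab : H.Reachable a b) : ¬ H.Reachable a c := by
  intro rac
  let S : Set V := {v | H.Reachable a v}
  have hconn : (H.induce S).Connected := by
    have h := (H.connectedComponentMk a).connected_toSimpleGraph
    have hS : (H.connectedComponentMk a).supp = S := by
      ext v
      simp only [SimpleGraph.ConnectedComponent.mem_supp_iff, SimpleGraph.ConnectedComponent.eq, S,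
        Set.mem_ofPred_eq]
      exact ⟨fun h => h.symm, fun h => h.symm⟩
    rw [← hS]
    exact h
  have hdeg : ∀ v : S, (H.induce S).degree v ≤ H.degree v := fun v => by
    rw [← SimpleGraph.card_neighborFinset_eq_degree, ← SimpleGraph.card_neighborFinset_eq_degree]
    refine Finset.card_le_card_of_injOn Subtype.val (fun w hw => ?_) Subtype.val_injective.injOn
    simpa using hw
  have hcard := hconn.card_vert_le_card_edgeSet_add_one
  have hsum := (H.induce S).sum_degrees_eq_twice_card_edges
  rw [Nat.card_eq_fintype_card, Nat.card_eq_fintype_card, ← SimpleGraph.edgeFinset_card] at hcard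
  let T : Finset S := {⟨a, SimpleGraph.Reachable.refl a⟩, ⟨b, rab⟩, ⟨c, rac⟩}
  have hT : T.card = 3 := Finset.card_eq_three.mpr
    ⟨_, _, _, by simpa using hab, by simpa using hac, by simpa using hbc, rfl⟩
  have hle : ∑ v : S, ((H.induce S).degree v + if v ∈ T then 1 else 0) ≤ ∑ _v : S, 2 := by
    refine Finset.sum_le_sum fun v _ => ?_
    have h := hdeg v
    split_ifs with hv
    · have : H.degree v ≤ 1 := by
        simp only [T, Finset.mem_insert, Finset.mem_singleton] at hv
        rcases hv with rfl | rfl | rfl <;> assumption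
      omega
    · have := h2 v
      omega
  rw [Finset.sum_add_distrib, hsum, Finset.sum_boole, Finset.filter_mem_eq_inter,
    Finset.univ_inter, hT] at hle
  simp only [Finset.sum_const, Finset.card_univ, smul_eq_mul, Nat.cast_ofNat] at hle
  omega

namespace EdgeColoring

variable {V C : Type*}

/-- A partial coloring of unordered pairs in which any two pairs of the same color sharing an
element coincide. -/
def Proper (χ : Sym2 V → Option C) : Prop :=
  ∀ v a b γ, χ s(v, a) = some γ → χ s(v, b) = some γ → a = b

/-- The color `γ` does not occur at the vertex `v`. -/
def Missing (χ : Sym2 V → Option C) (v : V) (γ : C) : Prop :=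
  ∀ a, χ s(v, a) ≠ some γ

theorem Proper.update [DecidableEq (Sym2 V)] {χ : Sym2 V → Option C} (h : Proper χ) {x y : V}
    {α : C} (hx : Missing χ x α) (hy : Missing χ y α) :
    Proper (Function.update χ s(x, y) (some α)) := by
  intro v a b γ ha hb
  simp only [Function.update_apply] at ha hb
  have key : ∀ w z, s(v, w) = s(x, y) → χ s(v, z) ≠ some α := by
    intro w z hw
    rcases Sym2.eq_iff.mp hw with ⟨rfl, -⟩ | ⟨rfl, -⟩
    exacts [hx z, hy z]
  split_ifs at ha hb with h1 h2 h2
  · exact Sym2.congr_right.mp (h1.trans h2.symm)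
  · exact absurd (hb.trans ha.symm) (key a b h1)
  · exact absurd (ha.trans hb.symm) (key b a h2)
  · exact h v a b γ ha hb

/-- `y 0, …, y k` is a Vizing fan around `x`: the color of each edge `x (y (i + 1))` is missing
at `y i`. -/
structure IsFan (χ : Sym2 V → Option C) (x : V) (y : ℕ → V) (k : ℕ) : Prop where
  injOn : Set.InjOn y (Set.Iic k)
  exists_missing : ∀ i < k, ∃ γ, χ s(x, y (i + 1)) = some γ ∧ Missing χ (y i) γ

/-- If some color is missing both at the center and at the last vertex of a fan, then rotating the
fan colors its first edge. -/
theorem Proper.exists_extend_of_isFan {x : V} {y : ℕ → V} (k : ℕ) {χ : Sym2 V → Option C}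
    (h : Proper χ) (hfan : IsFan χ x y k) {α : C} (hx : Missing χ x α)
    (hy : Missing χ (y k) α) :
    ∃ χ' : Sym2 V → Option C, Proper χ' ∧ ∀ e, χ' e ≠ none ↔ e = s(x, y 0) ∨ χ e ≠ none := by
  classical
  induction k generalizing χ α with
  | zero =>
    refine ⟨_, h.update hx hy, fun e => ?_⟩
    by_cases he : e = s(x, y 0) <;> simp [he]
  | succ k ih =>
    obtain ⟨γ, hγ, hmiss⟩ := hfan.exists_missing k (Nat.lt_succ_self k)
    have hne : ∀ i ≤ k, y i ≠ y (k + 1) := fun i hi heq => by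
      have := hfan.injOn (Set.mem_Iic.mpr (by omega)) (Set.mem_Iic.mpr le_rfl) heq
      omega
    have hαγ : α ≠ γ := fun heq => hx _ (heq ▸ hγ)
    set χ₁ := Function.update χ s(x, y (k + 1)) (some α) with hχ₁
    have hmissing : ∀ i ≤ k, ∀ δ, δ ≠ α → Missing χ (y i) δ → Missing χ₁ (y i) δ := by
      intro i hi δ hδ hm a ha
      rw [hχ₁, Function.update_apply] at ha
      split_ifs at ha
      · exact hδ (Option.some_injective _ ha).symm
      · exact hm a ha
    have hfan₁ : IsFan χ₁ x y k := by
      refine ⟨hfan.injOn.mono (Set.Iic_subset_Iic.mpr k.le_succ), fun i hi => ?_⟩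
      obtain ⟨δ, hδ, hm⟩ := hfan.exists_missing i (by omega)
      refine ⟨δ, ?_, hmissing i hi.le δ (fun heq => hx _ (heq ▸ hδ)) hm⟩
      rw [hχ₁, Function.update_of_ne, hδ]
      exact fun heq => hne (i + 1) hi (Sym2.congr_right.mp heq)
    have hx₁ : Missing χ₁ x γ := by
      intro a ha
      rw [hχ₁, Function.update_apply] at ha
      split_ifs at ha with hs
      · exact hαγ (Option.some_injective _ ha)
      · exact hs (congrArg _ (h x a _ γ ha hγ))
    obtain ⟨χ', hp, hs⟩ := ih (h.update hx hy) hfan₁ hx₁ (hmissing k le_rfl γ hαγ.symm hmiss)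
    refine ⟨χ', hp, fun e => (hs e).trans ?_⟩
    by_cases he : e = s(x, y (k + 1))
    · simp [he, hγ]
    · simp [he]

/-- The graph of the edges colored `α` or `β`. -/
def kempeGraph (χ : Sym2 V → Option C) (α β : C) : SimpleGraph V where
  Adj a b := a ≠ b ∧ (χ s(a, b) = some α ∨ χ s(a, b) = some β)
  symm := ⟨fun a b h => ⟨h.1.symm, by rw [Sym2.eq_swap]; exact h.2⟩⟩
  loopless := ⟨fun _ h => h.1 rfl⟩

open Classical in
theorem Proper.degree_kempeGraph_le [Fintype V] {χ : Sym2 V → Option C} (h : Proper χ) (α β : C)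
    (v : V) (s : Finset (Option C))
    (hs : ∀ w, χ s(v, w) = some α ∨ χ s(v, w) = some β → χ s(v, w) ∈ s) :
    (kempeGraph χ α β).degree v ≤ s.card := by
  rw [← SimpleGraph.card_neighborFinset_eq_degree]
  refine Finset.card_le_card_of_injOn (fun w => χ s(v, w)) (fun w hw => ?_) ?_
  · have hw' : (kempeGraph χ α β).Adj v w := by simpa using hw
    exact hs w hw'.2
  · intro a ha b _ hab
    have ha' : (kempeGraph χ α β).Adj v a := by simpa using ha
    obtain ⟨γ, hγ⟩ : ∃ γ, χ s(v, a) = some γ := ha'.2.elim (fun h => ⟨_, h⟩) fun h => ⟨_, h⟩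
    exact h v a b γ hγ (hab.symm.trans hγ)

/-- Two distinct vertices missing `β` and a third one missing `α` do not all lie on the same
Kempe chain. -/
theorem Proper.not_reachable_kempeGraph [Fintype V] {χ : Sym2 V → Option C} (h : Proper χ)
    {α β : C} {x u w : V} (hx : Missing χ x α) (hu : Missing χ u β) (hw : Missing χ w β)
    (hxu : x ≠ u) (hxw : x ≠ w) (huw : u ≠ w) (hr : (kempeGraph χ α β).Reachable x u) :
    ¬ (kempeGraph χ α β).Reachable x w := by
  classical
  have hβ : ∀ v, Missing χ v β → (kempeGraph χ α β).degree v ≤ 1 := fun v hv => by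
    simpa using h.degree_kempeGraph_le α β v {some α} fun z hz => by
      simpa using hz.resolve_right (hv z)
  refine (kempeGraph χ α β).not_reachable_of_degree_le_one (fun v => ?_) hxu hxw huw ?_
    (hβ u hu) (hβ w hw) hr
  · exact (h.degree_kempeGraph_le α β v {some α, some β} fun z hz => by simpa using hz).trans
      Finset.card_le_two
  · simpa using h.degree_kempeGraph_le α β x {some β} fun z hz => by
      simpa using hz.resolve_left (hx z)

open Classical in
/-- Exchange the colors `α` and `β` on the Kempe chain through `u`. -/
noncomputable def kempeSwap (χ : Sym2 V → Option C) (α β : C) (u : V) : Sym2 V → Option C :=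
  fun e => if ∃ v ∈ e, (kempeGraph χ α β).Reachable u v then (χ e).map (Equiv.swap α β) else χ e

theorem kempeSwap_ne_none_iff (χ : Sym2 V → Option C) (α β : C) (u : V) (e : Sym2 V) :
    kempeSwap χ α β u e ≠ none ↔ χ e ≠ none := by
  unfold kempeSwap
  split_ifs <;> simp

theorem kempeSwap_of_reachable [DecidableEq C] {χ : Sym2 V → Option C} {α β : C} {u v : V}
    (hv : (kempeGraph χ α β).Reachable u v) (a : V) :
    kempeSwap χ α β u s(v, a) = (χ s(v, a)).map (Equiv.swap α β) := by
  rw [kempeSwap, if_pos ⟨v, Sym2.mem_mk_left v a, hv⟩]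
  congr!

theorem kempeSwap_of_not_reachable {χ : Sym2 V → Option C} {α β : C} {u v : V}
    (hv : ¬ (kempeGraph χ α β).Reachable u v) (a : V) :
    kempeSwap χ α β u s(v, a) = χ s(v, a) := by
  classical
  rw [kempeSwap]
  split_ifs with hr
  · have ha : (kempeGraph χ α β).Reachable u a := by
      obtain ⟨w, hw, hrw⟩ := hr
      rcases Sym2.mem_iff.mp hw with rfl | rfl
      exacts [absurd hrw hv, hrw]
    have hadj : ¬ (kempeGraph χ α β).Adj v a := fun had => hv (ha.trans had.symm.reachable)
    have hva : v ≠ a := fun heq => hv (heq ▸ ha)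
    cases hc : χ s(v, a) with
    | none => rfl
    | some γ =>
      rw [Option.map_some, Equiv.swap_apply_of_ne_of_ne]
      · rintro rfl
        exact hadj ⟨hva, Or.inl hc⟩
      · rintro rfl
        exact hadj ⟨hva, Or.inr hc⟩
  · rfl

theorem Proper.kempeSwap {χ : Sym2 V → Option C} (h : Proper χ) (α β : C) (u : V) :
    Proper (kempeSwap χ α β u) := by
  classical
  intro v a b γ ha hb
  by_cases hv : (kempeGraph χ α β).Reachable u v
  · rw [kempeSwap_of_reachable hv, Option.map_eq_some_iff] at ha hb
    obtain ⟨γ₁, h₁, e₁⟩ := ha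
    obtain ⟨γ₂, h₂, e₂⟩ := hb
    obtain rfl := (Equiv.swap α β).injective (e₁.trans e₂.symm)
    exact h v a b _ h₁ h₂
  · rw [kempeSwap_of_not_reachable hv] at ha hb
    exact h v a b γ ha hb

theorem Missing.kempeSwap_of_not_reachable {χ : Sym2 V → Option C} {α β γ : C} {u v : V}
    (hm : Missing χ v γ) (hv : ¬ (kempeGraph χ α β).Reachable u v) :
    Missing (kempeSwap χ α β u) v γ := fun a => by
  rw [EdgeColoring.kempeSwap_of_not_reachable hv]
  exact hm a

theorem Missing.kempeSwap_self {χ : Sym2 V → Option C} {α β : C} {u : V}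
    (hm : Missing χ u β) : Missing (kempeSwap χ α β u) u α := fun a ha => by
  classical
  rw [kempeSwap_of_reachable (SimpleGraph.Reachable.refl u), Option.map_eq_some_iff] at ha
  obtain ⟨γ, h₁, h₂⟩ := ha
  obtain rfl : γ = β := (Equiv.swap_apply_eq_iff.mp h₂).trans (Equiv.swap_apply_left α β)
  exact hm a h₁

theorem Missing.kempeSwap_of_ne {χ : Sym2 V → Option C} {α β γ : C} {u v : V}
    (hm : Missing χ v γ) (hα : γ ≠ α) (hβ : γ ≠ β) : Missing (kempeSwap χ α β u) v γ := by
  classical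
  by_cases hv : (kempeGraph χ α β).Reachable u v
  · intro a ha
    rw [kempeSwap_of_reachable hv, Option.map_eq_some_iff] at ha
    obtain ⟨δ, h₁, h₂⟩ := ha
    obtain rfl : δ = γ :=
      (Equiv.swap_apply_eq_iff.mp h₂).trans (Equiv.swap_apply_of_ne_of_ne hα hβ)
    exact hm a h₁
  · exact hm.kempeSwap_of_not_reachable hv

/-- If the Kempe chain through the last vertex of a fan avoids its center, and the only fan vertex
whose successor edge is colored `β` is off that chain, then the fan can be used to color its first
edge. -/
theorem Proper.exists_extend_of_not_reachable {χ : Sym2 V → Option C} (h : Proper χ) {x : V}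
    {y : ℕ → V} {k : ℕ} (hfan : IsFan χ x y k) {α β : C} (hx : Missing χ x α)
    (hy : Missing χ (y k) β) (hr : ¬ (kempeGraph χ α β).Reachable (y k) x)
    (hβ : ∀ i < k, χ s(x, y (i + 1)) = some β → ¬ (kempeGraph χ α β).Reachable (y k) (y i)) :
    ∃ χ' : Sym2 V → Option C, Proper χ' ∧ ∀ e, χ' e ≠ none ↔ e = s(x, y 0) ∨ χ e ≠ none := by
  have hfan' : IsFan (EdgeColoring.kempeSwap χ α β (y k)) x y k := by
    refine ⟨hfan.injOn, fun i hi => ?_⟩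
    obtain ⟨γ, hγ, hm⟩ := hfan.exists_missing i hi
    refine ⟨γ, by rw [kempeSwap_of_not_reachable hr, hγ], ?_⟩
    by_cases hγβ : γ = β
    · exact hm.kempeSwap_of_not_reachable (hβ i hi (hγβ ▸ hγ))
    · exact hm.kempeSwap_of_ne (fun heq => hx _ (heq ▸ hγ)) hγβ
  obtain ⟨χ', hp, hs⟩ := (h.kempeSwap α β (y k)).exists_extend_of_isFan k hfan'
    (hx.kempeSwap_of_not_reachable hr) hy.kempeSwap_self
  exact ⟨χ', hp, fun e => by rw [hs, kempeSwap_ne_none_iff]⟩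

/-- If every vertex misses a color, then any uncolored pair can be colored. -/
theorem Proper.exists_extend [Finite V] {χ : Sym2 V → Option C} (h : Proper χ)
    (hmiss : ∀ v, ∃ γ, Missing χ v γ) {x y₀ : V} (hunc : χ s(x, y₀) = none) :
    ∃ χ' : Sym2 V → Option C, Proper χ' ∧ ∀ e, χ' e ≠ none ↔ e = s(x, y₀) ∨ χ e ≠ none := by
  classical
  have := Fintype.ofFinite V
  choose m hm using hmiss
  let next : V → V := fun w => if hw : ∃ z, χ s(x, z) = some (m w) then hw.choose else w
  have next_spec : ∀ w, (∃ z, χ s(x, z) = some (m w)) → χ s(x, next w) = some (m w) := by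
    intro w hw
    simp only [next, dif_pos hw]
    exact hw.choose_spec
  let y : ℕ → V := fun i => next^[i] y₀
  have y_succ : ∀ i, y (i + 1) = next (y i) := fun i => Function.iterate_succ_apply' next i y₀
  let F : ℕ → Prop := fun k =>
    Set.InjOn y (Set.Iic k) ∧ ∀ i < k, χ s(x, y (i + 1)) = some (m (y i))
  have isFan : ∀ k, F k → IsFan χ x y k := fun k hk => ⟨hk.1, fun i hi => ⟨_, hk.2 i hi, hm _⟩⟩
  have hF0 : F 0 := ⟨fun a ha b hb _ => by simp_all, fun i hi => absurd hi (Nat.not_lt_zero i)⟩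
  obtain ⟨k, hk, hk'⟩ : ∃ k, F k ∧ ¬ F (k + 1) := by
    by_contra! hcon
    have hall : ∀ k, F k := fun k => Nat.rec hF0 hcon k
    refine not_injective_infinite_finite y fun a b hab => ?_
    exact (hall (max a b)).1 (Set.mem_Iic.mpr (le_max_left a b)) (Set.mem_Iic.mpr (le_max_right a b))
      hab
  by_cases hz : ∃ z, χ s(x, z) = some (m (y k))
  swap
  · exact h.exists_extend_of_isFan k (isFan k hk) (fun a ha => hz ⟨a, ha⟩) (hm (y k))
  have hlast : χ s(x, y (k + 1)) = some (m (y k)) := by rw [y_succ]; exact next_spec _ hz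
  obtain ⟨j, hj, hyj⟩ : ∃ j ≤ k, y j = y (k + 1) := by
    by_contra! hcon
    refine hk' ⟨fun a ha b hb hab => ?_, fun i hi => ?_⟩
    · simp only [Set.mem_Iic] at ha hb
      rcases Nat.lt_or_eq_of_le ha with ha | rfl <;> rcases Nat.lt_or_eq_of_le hb with hb | rfl
      · exact hk.1 (Set.mem_Iic.mpr (by omega)) (Set.mem_Iic.mpr (by omega)) hab
      · exact absurd hab (hcon a (by omega))
      · exact absurd hab.symm (hcon b (by omega))
      · rfl
    · rcases Nat.lt_or_eq_of_le (Nat.le_of_lt_succ hi) with hi | rfl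
      exacts [hk.2 i hi, hlast]
  obtain _ | j := j
  · rw [← hyj] at hlast
    exact absurd (hunc.symm.trans hlast) (by simp)
  have hFj : F j :=
    ⟨hk.1.mono (Set.Iic_subset_Iic.mpr (by omega)), fun i hi => hk.2 i (by omega)⟩
  have hβ : m (y j) = m (y k) :=
    Option.some_injective _ ((hk.2 j hj).symm.trans (by rw [hyj, hlast]))
  have hmj : Missing χ (y j) (m (y k)) := hβ ▸ hm (y j)
  have hunique : ∀ i < k, χ s(x, y (i + 1)) = some (m (y k)) → i = j := fun i hi hc => by
    have := hk.1 (Set.mem_Iic.mpr hi) (Set.mem_Iic.mpr hj)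
      ((h x _ _ _ hc hlast).trans hyj.symm)
    omega
  have hxy : ∀ w, Missing χ w (m (y k)) → x ≠ w := fun w hw heq => hw _ (heq ▸ hlast)
  by_cases hr : (kempeGraph χ (m x) (m (y k))).Reachable x (y j)
  · have hjk : y j ≠ y k := fun heq => by
      have := hk.1 (Set.mem_Iic.mpr (by omega)) (Set.mem_Iic.mpr le_rfl) heq
      omega
    have hr' := h.not_reachable_kempeGraph (hm x) hmj (hm (y k)) (hxy _ hmj) (hxy _ (hm _)) hjk hr
    refine h.exists_extend_of_not_reachable (isFan k hk) (hm x) (hm (y k))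
      (fun hc => hr' hc.symm) fun i hi hc hreach => ?_
    obtain rfl := hunique i hi hc
    exact hr' (hr.trans hreach.symm)
  · refine h.exists_extend_of_not_reachable (isFan j hFj) (hm x) hmj (fun hc => hr hc.symm)
      fun i hi hc => ?_
    have := hunique i (by omega) hc
    omega

end EdgeColoring


/-- A partial `κ`-edge coloring of a simple graph `G`: edges may be uncolored (`none`),
and any two distinct colored edges sharing an endpoint receive distinct colors. -/
def IsPartialEdgeColoring {V : Type*} (G : SimpleGraph V) {κ : ℕ}
    (χ : Sym2 V → Option (Fin κ)) : Prop :=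
  ∀ e ∈ G.edgeSet, ∀ f ∈ G.edgeSet, e ≠ f → (∃ v : V, v ∈ e ∧ v ∈ f) →
    χ e ≠ none → χ f ≠ none → χ e ≠ χ f

/-- **One-edge color extension for Vizing's theorem**: any partial `(Δ+1)`-edge coloring of a
finite simple graph with maximum degree `Δ` can be extended to any given uncolored edge `e₀`,
possibly recoloring other edges, without uncoloring any edge. -/
theorem vizing_extend_one_edge {V : Type*} [Fintype V] (G : SimpleGraph V) [DecidableRel G.Adj]
    (Δ : ℕ) (hΔ : ∀ v : V, G.degree v ≤ Δ)
    (χ : Sym2 V → Option (Fin (Δ + 1))) (hχ : IsPartialEdgeColoring G χ)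
    (e₀ : Sym2 V) (he₀ : e₀ ∈ G.edgeSet) (hunc : χ e₀ = none) :
    ∃ χ' : Sym2 V → Option (Fin (Δ + 1)), IsPartialEdgeColoring G χ' ∧
      {e : Sym2 V | e ∈ G.edgeSet ∧ χ' e ≠ none} =
        insert e₀ {e : Sym2 V | e ∈ G.edgeSet ∧ χ e ≠ none} := by
  classical
  let χ₀ : Sym2 V → Option (Fin (Δ + 1)) := fun e => if e ∈ G.edgeSet then χ e else none
  have adj_of_some : ∀ v a γ, χ₀ s(v, a) = some γ → G.Adj v a ∧ χ s(v, a) = some γ := by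
    intro v a γ h
    simp only [χ₀] at h
    split_ifs at h with he
    exact ⟨he, h⟩
  have hproper : EdgeColoring.Proper χ₀ := by
    intro v a b γ ha hb
    obtain ⟨ha₁, ha₂⟩ := adj_of_some v a γ ha
    obtain ⟨hb₁, hb₂⟩ := adj_of_some v b γ hb
    by_contra hab
    exact hχ s(v, a) ha₁ s(v, b) hb₁ (fun heq => hab (Sym2.congr_right.mp heq))
      ⟨v, Sym2.mem_mk_left v a, Sym2.mem_mk_left v b⟩ (by simp [ha₂]) (by simp [hb₂])
      (ha₂.trans hb₂.symm)
  have hmiss : ∀ v, ∃ γ, EdgeColoring.Missing χ₀ v γ := by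
    intro v
    by_contra! hcon
    simp only [EdgeColoring.Missing, not_forall, not_not] at hcon
    choose a ha using hcon
    have hcard : (Finset.univ : Finset (Fin (Δ + 1))).card ≤ (G.neighborFinset v).card := by
      refine Finset.card_le_card_of_injOn a (fun γ _ => ?_) fun γ _ δ _ heq => ?_
      · simpa using (adj_of_some v _ γ (ha γ)).1
      · exact Option.some_injective _ ((ha γ).symm.trans (by rw [heq, ha δ]))
    rw [Finset.card_univ, Fintype.card_fin, SimpleGraph.card_neighborFinset_eq_degree] at hcard
    have := hΔ v
    omega
  induction e₀ with | _ x y₀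
  have hunc₀ : χ₀ s(x, y₀) = none := by simp [χ₀, hunc]
  obtain ⟨χ', hp, hs⟩ := hproper.exists_extend hmiss hunc₀
  refine ⟨χ', ?_, ?_⟩
  · rintro e - f - hne ⟨v, hve, hvf⟩ he hf heq
    obtain ⟨a, rfl⟩ := hve
    obtain ⟨b, rfl⟩ := hvf
    obtain ⟨γ, hγ⟩ := Option.ne_none_iff_exists'.mp he
    exact hne (congrArg _ (hp v a b γ hγ (heq.symm.trans hγ)))
  · ext e
    simp only [Set.mem_ofPred_eq, Set.mem_insert_iff, hs, χ₀]
    constructor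
    · rintro ⟨he, h | h⟩
      · exact Or.inl h
      · exact Or.inr ⟨he, by rwa [if_pos he] at h⟩
    · rintro (rfl | ⟨he, h⟩)
      · exact ⟨he₀, Or.inl rfl⟩
      · exact ⟨he, Or.inr (by rwa [if_pos he])⟩
end

section
/- Every finite loopless multigraph G with maximum degree Δ and maximum edge multiplicity μ admits a proper (Δ+μ)-edge coloring, i.e., a map assigning to each edge a color in {1,…,Δ+μ} so that any two distinct edges sharing an endpoint—including parallel edges—receive distinct colors. -/
namespace VizingMultigraph

open Finset

/-- A connected graph of maximum degree two does not have three vertices of degree at most one. -/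
theorem false_of_connected_of_three_degree_le_one {W : Type*} [Fintype W] [DecidableEq W]
    (G : SimpleGraph W) [DecidableRel G.Adj] (hG : G.Connected) (h2 : ∀ w, G.degree w ≤ 2)
    {x y z : W} (hxy : x ≠ y) (hxz : x ≠ z) (hyz : y ≠ z)
    (hx : G.degree x ≤ 1) (hy : G.degree y ≤ 1) (hz : G.degree z ≤ 1) : False := by
  have hE := hG.card_vert_le_card_edgeSet_add_one
  rw [Nat.card_eq_fintype_card, Nat.card_eq_fintype_card, ← SimpleGraph.edgeFinset_card] at hE
  have hsum := G.sum_degrees_eq_twice_card_edges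
  have hsub : ∑ w, G.degree w + ∑ w, (if w ∈ ({x, y, z} : Finset W) then 1 else 0)
      ≤ ∑ _w : W, 2 := by
    rw [← Finset.sum_add_distrib]
    refine Finset.sum_le_sum fun w _ => ?_
    split_ifs with h
    · simp only [Finset.mem_insert, Finset.mem_singleton] at h
      rcases h with rfl | rfl | rfl <;> omega
    · simpa using h2 w
  have h3 : ({x, y, z} : Finset W).card = 3 := Finset.card_eq_three.2 ⟨x, y, z, hxy, hxz, hyz, rfl⟩
  simp only [Finset.sum_ite_mem, Finset.univ_inter, Finset.sum_const, h3, Finset.card_univ,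
    smul_eq_mul] at hsub
  omega

/-- In a graph of maximum degree two, three distinct vertices of degree at most one are never
in the same connected component. -/
theorem false_of_reachable_of_three_degree_le_one {W : Type*} [Fintype W]
    (G : SimpleGraph W) (h2 : ∀ w, (G.neighborSet w).ncard ≤ 2)
    {x y z : W} (hxy : x ≠ y) (hxz : x ≠ z) (hyz : y ≠ z)
    (hx : (G.neighborSet x).ncard ≤ 1) (hy : (G.neighborSet y).ncard ≤ 1)
    (hz : (G.neighborSet z).ncard ≤ 1)
    (hrxz : G.Reachable x z) (hryz : G.Reachable y z) : False := by
  classical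
  let C := G.connectedComponentMk z
  have hdeg (w : C.supp) : (G.induce C.supp).degree w ≤ (G.neighborSet w.1).ncard := by
    rw [← SimpleGraph.card_neighborSet_eq_degree, ← Nat.card_eq_fintype_card, Nat.card_coe_set_eq]
    refine Set.ncard_le_ncard_of_injOn Subtype.val (fun u hu => ?_)
      Subtype.val_injective.injOn (Set.toFinite _)
    simpa using hu
  exact false_of_connected_of_three_degree_le_one (G.induce C.supp)
    C.connected_toSimpleGraph (fun w => (hdeg w).trans (h2 w))
    (x := ⟨x, SimpleGraph.ConnectedComponent.sound hrxz⟩)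
    (y := ⟨y, SimpleGraph.ConnectedComponent.sound hryz⟩) (z := ⟨z, rfl⟩)
    (fun h => hxy (congrArg Subtype.val h)) (fun h => hxz (congrArg Subtype.val h))
    (fun h => hyz (congrArg Subtype.val h))
    ((hdeg _).trans hx) ((hdeg _).trans hy) ((hdeg _).trans hz)

variable {V E K : Type*}

/-- A partial edge coloring is proper if distinct colored edges with a common endpoint have
distinct colors. -/
def Proper (ends : E → Sym2 V) (c : E → Option K) : Prop :=
  ∀ ⦃e f : E⦄ ⦃a : K⦄ ⦃w : V⦄, w ∈ ends e → w ∈ ends f → c e = some a → c f = some a → e = f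

/-- The color `a` does not occur at the vertex `w`. -/
def Misses (ends : E → Sym2 V) (c : E → Option K) (w : V) (a : K) : Prop :=
  ∀ e, w ∈ ends e → c e ≠ some a

/-- Some proper partial coloring colors `e₀` and every edge colored by `c`. -/
def Extendable (ends : E → Sym2 V) (c : E → Option K) (e₀ : E) : Prop :=
  ∃ c' : E → Option K, Proper ends c' ∧ ∀ e, c' e = none → c e = none ∧ e ≠ e₀

/-- The graph formed by the edges of color `a` or `b`. -/
def kempeGraph (ends : E → Sym2 V) (c : E → Option K) (a b : K) : SimpleGraph V where
  Adj u w := u ≠ w ∧ ∃ e, ends e = s(u, w) ∧ (c e = some a ∨ c e = some b)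
  symm := ⟨fun u w ⟨h, e, he, hc⟩ => ⟨h.symm, e, by rw [he, Sym2.eq_swap], hc⟩⟩
  loopless := ⟨fun _ h => h.1 rfl⟩

theorem ncard_neighborSet_kempeGraph_le {ends : E → Sym2 V} {c : E → Option K}
    (hc : Proper ends c) (a b : K) (w : V) (T : Set K) (hT : T.Finite)
    (h : ∀ e x, w ∈ ends e → c e = some x → x = a ∨ x = b → x ∈ T) :
    ((kempeGraph ends c a b).neighborSet w).ncard ≤ T.ncard := by
  have key (u : V) (hu : u ∈ (kempeGraph ends c a b).neighborSet w) :
      ∃ x ∈ T, ∃ e, ends e = s(w, u) ∧ c e = some x := by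
    obtain ⟨-, e, he, hce⟩ := hu
    rcases hce with hce | hce
    · exact ⟨a, h e a (by simp [he]) hce (Or.inl rfl), e, he, hce⟩
    · exact ⟨b, h e b (by simp [he]) hce (Or.inr rfl), e, he, hce⟩
  have : Nonempty K := ⟨a⟩
  choose! f hfT hf using key
  refine Set.ncard_le_ncard_of_injOn f hfT (fun u hu u' hu' huu => ?_) hT
  obtain ⟨e, he, hce⟩ := hf u hu
  obtain ⟨e', he', hce'⟩ := hf u' hu'
  obtain rfl : e = e' := hc (w := w) (by simp [he]) (by simp [he']) hce (huu ▸ hce')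
  exact Sym2.congr_right.1 (he.symm.trans he')

theorem ncard_neighborSet_kempeGraph_le_two {ends : E → Sym2 V} {c : E → Option K}
    (hc : Proper ends c) (a b : K) (w : V) :
    ((kempeGraph ends c a b).neighborSet w).ncard ≤ 2 :=
  (ncard_neighborSet_kempeGraph_le hc a b w {a, b} (Set.toFinite _)
    (fun _ _ _ _ h => h)).trans (Set.ncard_insert_le a {b} |>.trans (by simp))

theorem ncard_neighborSet_kempeGraph_le_one {ends : E → Sym2 V} {c : E → Option K}
    (hc : Proper ends c) (a b : K) (w : V) (h : Misses ends c w a ∨ Misses ends c w b) :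
    ((kempeGraph ends c a b).neighborSet w).ncard ≤ 1 := by
  rcases h with h | h
  · rw [← Set.ncard_singleton b]
    refine ncard_neighborSet_kempeGraph_le hc a b w {b} (Set.toFinite _) ?_
    rintro e x he hx (rfl | rfl)
    · exact absurd hx (h e he)
    · rfl
  · rw [← Set.ncard_singleton a]
    refine ncard_neighborSet_kempeGraph_le hc a b w {a} (Set.toFinite _) ?_
    rintro e x he hx (rfl | rfl)
    · rfl
    · exact absurd hx (h e he)

open Classical in
/-- Exchange the colors `a` and `b` on the edges that touch `S`. -/
noncomputable def kempeSwap [DecidableEq K] (ends : E → Sym2 V) (c : E → Option K)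
    (a b : K) (S : Set V) : E → Option K :=
  fun e => if ∃ u ∈ ends e, u ∈ S then (c e).map (Equiv.swap a b) else c e

/-- `S` is a union of components of the graph of edges colored `a` or `b`. -/
def KempeClosed (ends : E → Sym2 V) (c : E → Option K) (a b : K) (S : Set V) : Prop :=
  ∀ e, c e = some a ∨ c e = some b → ∀ u ∈ ends e, ∀ w ∈ ends e, u ∈ S → w ∈ S

theorem kempeClosed_setOf_reachable (ends : E → Sym2 V) (c : E → Option K) (a b : K) (x : V) :
    KempeClosed ends c a b {w | (kempeGraph ends c a b).Reachable x w} := by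
  intro e he u hu w hw hxu
  by_cases huw : u = w
  · exact huw ▸ hxu
  · have : (kempeGraph ends c a b).Adj u w :=
      ⟨huw, e, (Sym2.mem_and_mem_iff huw).1 ⟨hu, hw⟩, he⟩
    exact SimpleGraph.Reachable.trans hxu this.reachable

section Swap

variable [DecidableEq K] {ends : E → Sym2 V} {c : E → Option K} {a b : K} {S : Set V}

theorem kempeSwap_of_mem {e : E} {w : V} (hw : w ∈ ends e)
    (hwS : w ∈ S) : kempeSwap ends c a b S e = (c e).map (Equiv.swap a b) :=
  if_pos ⟨w, hw, hwS⟩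

theorem kempeSwap_of_notMem (hS : KempeClosed ends c a b S) {e : E} {w : V} (hw : w ∈ ends e)
    (hwS : w ∉ S) : kempeSwap ends c a b S e = c e := by
  unfold kempeSwap
  split_ifs with h
  · obtain ⟨u, hu, huS⟩ := h
    have hne : ¬ (c e = some a ∨ c e = some b) := fun h => hwS (hS e h u hu w hw huS)
    rcases hx : c e with _ | x
    · rfl
    · have hxa : x ≠ a := by rintro rfl; exact hne (Or.inl hx)
      have hxb : x ≠ b := by rintro rfl; exact hne (Or.inr hx)
      simp [Equiv.swap_apply_of_ne_of_ne hxa hxb]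
  · rfl

theorem kempeSwap_eq_none_iff {e : E} : kempeSwap ends c a b S e = none ↔ c e = none := by
  unfold kempeSwap
  split_ifs <;> simp

theorem Proper.kempeSwap (hc : Proper ends c) (hS : KempeClosed ends c a b S) :
    Proper ends (kempeSwap ends c a b S) := by
  intro e f x w he hf hce hcf
  by_cases hw : w ∈ S
  · rw [kempeSwap_of_mem he hw, Option.map_eq_some_iff] at hce
    rw [kempeSwap_of_mem hf hw, Option.map_eq_some_iff] at hcf
    obtain ⟨y, hy, hyx⟩ := hce
    obtain ⟨z, hz, hzx⟩ := hcf
    obtain rfl : y = z := (Equiv.swap a b).injective (hyx.trans hzx.symm)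
    exact hc he hf hy hz
  · rw [kempeSwap_of_notMem hS he hw] at hce
    rw [kempeSwap_of_notMem hS hf hw] at hcf
    exact hc he hf hce hcf

theorem Misses.kempeSwap_of_mem {w : V} {x : K} (hw : w ∈ S)
    (h : Misses ends c w x) : Misses ends (kempeSwap ends c a b S) w (Equiv.swap a b x) := by
  intro e he hce
  rw [VizingMultigraph.kempeSwap_of_mem he hw, Option.map_eq_some_iff] at hce
  obtain ⟨y, hy, hyx⟩ := hce
  exact h e he (hy.trans (congrArg some ((Equiv.swap a b).injective hyx)))

theorem Misses.kempeSwap_of_notMem (hS : KempeClosed ends c a b S) {w : V} {x : K} (hw : w ∉ S)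
    (h : Misses ends c w x) : Misses ends (kempeSwap ends c a b S) w x := by
  intro e he hce
  rw [VizingMultigraph.kempeSwap_of_notMem hS he hw] at hce
  exact h e he hce

end Swap

theorem Proper.update [DecidableEq E] {ends : E → Sym2 V} {c : E → Option K}
    (hc : Proper ends c) {e : E} {a : K} (h : ∀ w ∈ ends e, Misses ends c w a) :
    Proper ends (Function.update c e (some a)) := by
  intro f g x w hf hg hcf hcg
  rw [Function.update_apply] at hcf hcg
  split_ifs at hcf hcg with h1 h2 h2
  · rw [h1, h2]
  · subst h1
    obtain rfl : a = x := by simpa using hcf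
    exact absurd hcg (h w hf g hg)
  · subst h2
    obtain rfl : a = x := by simpa using hcg
    exact absurd hcf (h w hg f hf)
  · exact hc hf hg hcf hcg

/-- Vizing fans at `v` starting from the edge `e₀`, listed in reverse order: the color of each
further edge is missing at the far endpoint `y e` of its predecessor `e`. -/
inductive IsFan (ends : E → Sym2 V) (v : V) (y : E → V) (e₀ : E) (c : E → Option K) :
    List E → Prop
  | single : IsFan ends v y e₀ c [e₀]
  | cons {f e : E} {l : List E} {x : K} : IsFan ends v y e₀ c (e :: l) → f ∉ e :: l →
      v ∈ ends f → c f = some x → Misses ends c (y e) x → IsFan ends v y e₀ c (f :: e :: l)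

namespace IsFan

variable {ends : E → Sym2 V} {v : V} {y : E → V} {e₀ : E} {c c' : E → Option K}

theorem mem_ends (he₀ : v ∈ ends e₀) {L : List E} (hL : IsFan ends v y e₀ c L) :
    ∀ e ∈ L, v ∈ ends e := by
  induction hL with
  | single => simpa using he₀
  | cons _ _ hv _ _ ih => exact List.forall_mem_cons.2 ⟨hv, ih⟩

theorem exists_of_mem {L : List E} (hL : IsFan ends v y e₀ c L) {f : E} (hf : f ∈ L) :
    ∃ l, IsFan ends v y e₀ c (f :: l) ∧ l.length < L.length := by
  induction hL with
  | single =>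
    obtain rfl : f = e₀ := by simpa using hf
    exact ⟨[], .single, by simp⟩
  | @cons g e l x h1 h2 h3 h4 h5 ih =>
    rcases List.mem_cons.1 hf with rfl | hf
    · exact ⟨e :: l, .cons h1 h2 h3 h4 h5, by simp⟩
    · obtain ⟨l', hl', hlen⟩ := ih hf
      exact ⟨l', hl', hlen.trans (by simp)⟩

theorem congr {L : List E} (hL : IsFan ends v y e₀ c L) (hcol : ∀ e ∈ L, c' e = c e)
    (hmiss : ∀ e ∈ L.tail, ∀ f x, v ∈ ends f → c f = some x → Misses ends c (y e) x →
      Misses ends c' (y e) x) : IsFan ends v y e₀ c' L := by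
  induction hL with
  | single => exact .single
  | @cons f e l x h1 h2 h3 h4 h5 ih =>
    refine .cons (ih (fun g hg => hcol g (List.mem_cons_of_mem _ hg))
      fun g hg => hmiss g (List.mem_of_mem_tail hg)) h2 h3 ((hcol f (by simp)).trans h4) ?_
    exact hmiss e (by simp) f x h3 h4 h5

/-- A fan can be rotated if some color is missing both at its center and at its last vertex. -/
theorem extendable_of_misses (hy : ∀ e, v ∈ ends e → ends e = s(v, y e)) (he₀ : v ∈ ends e₀)
    {l : List E} {e : E} {a : K} (hc : Proper ends c) (hl : IsFan ends v y e₀ c (e :: l))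
    (hv : Misses ends c v a) (hye : Misses ends c (y e) a) : Extendable ends c e₀ := by
  classical
  induction l generalizing c e a with
  | nil =>
    cases hl
    refine ⟨Function.update c e₀ (some a), hc.update ?_, fun e he => ?_⟩
    · rw [hy e₀ he₀]
      simp [hv, hye]
    · rw [Function.update_apply] at he
      split_ifs at he with h
      exact ⟨he, h⟩
  | cons g l ih =>
    obtain _ | @⟨_, _, _, x, h1, h2, h3, h4, h5⟩ := hl
    have hxa : a ≠ x := by rintro rfl; exact hv e h3 h4
    have hmiss {w : V} {z : K} (hz : a ≠ z) (h : ∀ f, w ∈ ends f → f ≠ e → c f ≠ some z) :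
        Misses ends (Function.update c e (some a)) w z := by
      intro f hf hcf
      rw [Function.update_apply] at hcf
      split_ifs at hcf with hfe
      · exact hz (by simpa using hcf)
      · exact h f hf hfe hcf
    have hc1 : Proper ends (Function.update c e (some a)) := by
      refine hc.update ?_
      rw [hy e h3]
      simp [hv, hye]
    have hfan : IsFan ends v y e₀ (Function.update c e (some a)) (g :: l) := by
      refine h1.congr (fun f hf => ?_) fun f _ f' z hf' hcf' hz => ?_
      · exact Function.update_of_ne (by rintro rfl; exact h2 hf) _ _
      · exact hmiss (by rintro rfl; exact hv f' hf' hcf') fun f'' h _ => hz f'' h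
    obtain ⟨c', hc', hn⟩ := ih hc1 hfan
      (hmiss hxa fun f hf hfe hcf => hfe (hc hf h3 hcf h4)) (hmiss hxa fun f hf _ => h5 f hf)
    refine ⟨c', hc', fun f hf => ⟨?_, (hn f hf).2⟩⟩
    have := (hn f hf).1
    rw [Function.update_apply] at this
    split_ifs at this
    exact this

/-- If the coloring cannot be extended, then the Kempe chain from a fan vertex leads to the
center of the fan. -/
theorem reachable_of_misses (hy : ∀ e, v ∈ ends e → ends e = s(v, y e)) (he₀ : v ∈ ends e₀)
    (hc : Proper ends c) (hext : ¬ Extendable ends c e₀) {a b : K} (hv : Misses ends c v a)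
    {l : List E} {e : E} (hl : IsFan ends v y e₀ c (e :: l)) (hye : Misses ends c (y e) b) :
    (kempeGraph ends c a b).Reachable (y e) v := by
  classical
  induction hn : l.length using Nat.strong_induction_on generalizing l e with
  | _ n ih =>
  subst hn
  by_contra hnot
  apply hext
  set S : Set V := {w | (kempeGraph ends c a b).Reachable (y e) w} with hSdef
  have hS : KempeClosed ends c a b S := kempeClosed_setOf_reachable ends c a b (y e)
  have hvS : v ∉ S := hnot
  have hyS : y e ∈ S := SimpleGraph.Reachable.refl _
  have hfan : IsFan ends v y e₀ (kempeSwap ends c a b S) (e :: l) := by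
    refine hl.congr (fun g hg => kempeSwap_of_notMem hS (hl.mem_ends he₀ g hg) hvS)
      fun g hg f x hf hcf hx => ?_
    have hxa : x ≠ a := by rintro rfl; exact hv f hf hcf
    by_cases hgS : y g ∈ S
    · by_cases hxb : x = b
      · subst hxb
        have hgl : g ∈ l := hg
        cases hl with
        | single => simp at hgl
        | cons h1 =>
          obtain ⟨l', hl', hlen⟩ := h1.exists_of_mem hgl
          exact absurd (SimpleGraph.Reachable.trans hgS (ih _ hlen hl' hx rfl)) hnot
      · simpa [Equiv.swap_apply_of_ne_of_ne hxa hxb] using hx.kempeSwap_of_mem (a := a) (b := b) hgS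
    · exact hx.kempeSwap_of_notMem hS hgS
  obtain ⟨c', hc', hn⟩ := hfan.extendable_of_misses hy he₀ (hc.kempeSwap hS)
    (hv.kempeSwap_of_notMem hS hvS) (by simpa using hye.kempeSwap_of_mem (a := a) (b := b) hyS)
  exact ⟨c', hc', fun f hf => ⟨kempeSwap_eq_none_iff.1 (hn f hf).1, (hn f hf).2⟩⟩

end IsFan

open Classical in
/-- A vertex of degree at most `Δ` misses at least `μ` of `Δ + μ` colors. -/
theorem le_card_filter_misses [Fintype E] {ends : E → Sym2 V} {Δ μ : ℕ}
    (c : E → Option (Fin (Δ + μ))) (w : V) (hΔ : Nat.card {e : E // w ∈ ends e} ≤ Δ) :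
    μ ≤ #{a | Misses ends c w a} := by
  have h1 : #{a | ¬ Misses ends c w a} ≤ #{e | w ∈ ends e} := by
    rw [← Finset.card_image_of_injective _ (Option.some_injective (Fin (Δ + μ)))]
    refine (Finset.card_le_card (t := ({e | w ∈ ends e} : Finset E).image c) ?_).trans
      Finset.card_image_le
    intro o ho
    simp only [Finset.mem_image, Finset.mem_filter, Finset.mem_univ, true_and] at ho ⊢
    obtain ⟨a, ha, rfl⟩ := ho
    simpa [Misses] using ha
  have h2 := Finset.card_filter_add_card_filter_not (s := (univ : Finset (Fin (Δ + μ))))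
    (fun a => Misses ends c w a)
  rw [Nat.card_eq_fintype_card, Fintype.card_subtype] at hΔ
  simp only [Finset.card_univ, Fintype.card_fin] at h2
  omega

/-- Every proper partial `(Δ + μ)`-edge coloring can be extended, after recoloring, to any given
uncolored edge. -/
theorem extendable [Fintype V] [Fintype E] {ends : E → Sym2 V}
    (hloopless : ∀ e : E, ¬ (ends e).IsDiag) {Δ μ : ℕ}
    (hΔ : ∀ v : V, Nat.card {e : E // v ∈ ends e} ≤ Δ)
    (hμ : ∀ p : Sym2 V, Nat.card {e : E // ends e = p} ≤ μ)
    {c : E → Option (Fin (Δ + μ))} (hc : Proper ends c) {e₀ : E} (h₀ : c e₀ = none) :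
    Extendable ends c e₀ := by
  classical
  by_contra hext
  obtain ⟨v, he₀⟩ : ∃ v, v ∈ ends e₀ := ⟨_, (ends e₀).out_fst_mem⟩
  obtain ⟨y, hy⟩ : ∃ y : E → V, ∀ e, v ∈ ends e → ends e = s(v, y e) := by
    have (e : E) : ∃ w, v ∈ ends e → ends e = s(v, w) := by
      by_cases h : v ∈ ends e
      · obtain ⟨w, hw⟩ := Sym2.mem_iff_exists.1 h
        exact ⟨w, fun _ => hw⟩
      · exact ⟨v, fun h' => absurd h' h⟩
    exact ⟨fun e => (this e).choose, fun e => (this e).choose_spec⟩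
  have hyv (e : E) (he : v ∈ ends e) : y e ≠ v := fun h =>
    hloopless e (by rw [hy e he, h]; simp)
  have hμpos : 0 < μ := by
    refine lt_of_lt_of_le ?_ (hμ (ends e₀))
    have : Nonempty {e : E // ends e = ends e₀} := ⟨⟨e₀, rfl⟩⟩
    exact Nat.card_pos
  obtain ⟨a, ha⟩ : ∃ a, Misses ends c v a := by
    obtain ⟨a, ha⟩ := Finset.card_pos.1 (hμpos.trans_le (le_card_filter_misses c v (hΔ v)))
    exact ⟨a, by simpa using ha⟩
  let F : Finset E := {e | ∃ l, IsFan ends v y e₀ c (e :: l)}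
  have hF {e : E} : e ∈ F ↔ ∃ l, IsFan ends v y e₀ c (e :: l) := by simp [F]
  have hFv {e : E} (he : e ∈ F) : v ∈ ends e := by
    obtain ⟨l, hl⟩ := hF.1 he
    exact hl.mem_ends he₀ e (by simp)
  have he₀F : e₀ ∈ F := hF.2 ⟨[], .single⟩
  let M : V → Finset (Fin (Δ + μ)) := fun w => {b | Misses ends c w b}
  have hdisj : ((F.image y : Finset V) : Set V).PairwiseDisjoint M := by
    intro u hu w hw huw
    simp only [Finset.coe_image, Set.mem_image, Finset.mem_coe] at hu hw
    obtain ⟨e, he, rfl⟩ := hu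
    obtain ⟨f, hf, rfl⟩ := hw
    refine Finset.disjoint_left.2 fun b hb hb' => ?_
    have hb : Misses ends c (y e) b := by simpa [M] using hb
    have hb' : Misses ends c (y f) b := by simpa [M] using hb'
    obtain ⟨l, hl⟩ := hF.1 he
    obtain ⟨l', hl'⟩ := hF.1 hf
    exact false_of_reachable_of_three_degree_le_one (kempeGraph ends c a b)
      (ncard_neighborSet_kempeGraph_le_two hc a b) huw (hyv e (hFv he)) (hyv f (hFv hf))
      (ncard_neighborSet_kempeGraph_le_one hc a b _ (Or.inr hb))
      (ncard_neighborSet_kempeGraph_le_one hc a b _ (Or.inr hb'))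
      (ncard_neighborSet_kempeGraph_le_one hc a b _ (Or.inl ha))
      (hl.reachable_of_misses hy he₀ hc hext ha hb)
      (hl'.reachable_of_misses hy he₀ hc hext ha hb')
  have hsub : ((F.image y).biUnion M).image some ⊆ (F.erase e₀).image c := by
    intro o ho
    simp only [Finset.mem_image, Finset.mem_biUnion, M, Finset.mem_filter, Finset.mem_univ,
      true_and] at ho
    obtain ⟨b, ⟨_, ⟨e, he, rfl⟩, hb⟩, rfl⟩ := ho
    obtain ⟨l, hl⟩ := hF.1 he
    have hvb : ¬ Misses ends c v b := fun h =>
      hext (hl.extendable_of_misses hy he₀ hc h hb)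
    simp only [Misses, not_forall, not_not] at hvb
    obtain ⟨f, hf, hcf⟩ := hvb
    refine Finset.mem_image.2 ⟨f, Finset.mem_erase.2 ⟨?_, hF.2 ?_⟩, hcf⟩
    · rintro rfl
      simp [h₀] at hcf
    · by_cases hfl : f ∈ e :: l
      · obtain ⟨l', hl', -⟩ := hl.exists_of_mem hfl
        exact ⟨l', hl'⟩
      · exact ⟨e :: l, .cons hl hfl hf hcf hb⟩
  have h1 : #(F.image y) * μ ≤ #((F.image y).biUnion M) := by
    rw [Finset.card_biUnion hdisj]
    exact Finset.card_nsmul_le_sum _ _ _ fun w _ => le_card_filter_misses c w (hΔ w)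
  have h2 : #((F.image y).biUnion M) ≤ #(F.erase e₀) := by
    rw [← Finset.card_image_of_injective _ (Option.some_injective (Fin (Δ + μ)))]
    exact (Finset.card_le_card hsub).trans Finset.card_image_le
  have h3 : #F ≤ μ * #(F.image y) := by
    refine Finset.card_le_mul_card_image _ _ fun w _ => le_trans (Finset.card_le_card ?_)
      ((Fintype.card_subtype _).symm.trans_le (Nat.card_eq_fintype_card.symm.trans_le (hμ s(v, w))))
    intro e he
    obtain ⟨heF, rfl⟩ := Finset.mem_filter.1 he
    simpa using hy e (hFv heF)
  have h4 := Finset.card_erase_lt_of_mem he₀F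
  rw [mul_comm] at h3
  omega

/-- A multigraph has a proper partial `(Δ + μ)`-edge coloring that colors every edge. -/
theorem exists_proper_forall_ne_none [Fintype V] [Fintype E] {ends : E → Sym2 V}
    (hloopless : ∀ e : E, ¬ (ends e).IsDiag) {Δ μ : ℕ}
    (hΔ : ∀ v : V, Nat.card {e : E // v ∈ ends e} ≤ Δ)
    (hμ : ∀ p : Sym2 V, Nat.card {e : E // ends e = p} ≤ μ) :
    ∃ c : E → Option (Fin (Δ + μ)), Proper ends c ∧ ∀ e, c e ≠ none := by
  classical
  obtain ⟨c, hc, hmin⟩ := exists_minimalFor_of_wellFoundedLT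
    (Proper (K := Fin (Δ + μ)) ends) (fun c => #{e | c e = none})
    ⟨fun _ => none, fun _ _ _ _ _ _ h => by simp at h⟩
  refine ⟨c, hc, fun e₀ h₀ => ?_⟩
  obtain ⟨c', hc', hn⟩ := extendable hloopless hΔ hμ hc h₀
  have hlt : #{e | c' e = none} < #{e | c e = none} := by
    refine Finset.card_lt_card (Finset.ssubset_iff_of_subset ?_ |>.2 ⟨e₀, by simpa using h₀, ?_⟩)
    · intro e he
      simpa using (hn e (by simpa using he)).1
    · intro he
      exact (hn e₀ (by simpa using he)).2 rfl
  exact absurd (hmin hc' hlt.le) (not_le.2 hlt)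

end VizingMultigraph

/-- **Vizing's theorem for multigraphs**: every finite loopless multigraph (given by an
endpoint map `ends : E → Sym2 V` with no diagonal values) with maximum degree `Δ` and maximum
edge multiplicity `μ` admits a proper `(Δ+μ)`-edge coloring: any two distinct edges sharing
an endpoint — including parallel edges — receive distinct colors. -/
theorem vizing_multigraph_edge_coloring {V E : Type*} [Fintype V] [Fintype E]
    (ends : E → Sym2 V) (hloopless : ∀ e : E, ¬ (ends e).IsDiag)
    (Δ μ : ℕ)
    (hΔ : ∀ v : V, Nat.card {e : E // v ∈ ends e} ≤ Δ)
    (hμ : ∀ p : Sym2 V, Nat.card {e : E // ends e = p} ≤ μ) :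
    ∃ χ : E → Fin (Δ + μ),
      ∀ e f : E, e ≠ f → (∃ v : V, v ∈ ends e ∧ v ∈ ends f) → χ e ≠ χ f := by
  obtain ⟨c, hc, hne⟩ := VizingMultigraph.exists_proper_forall_ne_none hloopless hΔ hμ
  choose χ hχ using fun e => Option.ne_none_iff_exists'.1 (hne e)
  exact ⟨χ, fun e f hef ⟨v, he, hf⟩ h => hef (hc he hf (hχ e) (h ▸ hχ f))⟩
end

section
/- Let G be a finite loopless multigraph with maximum degree Δ and maximum edge multiplicity μ, let χ be a partial (Δ+μ)-edge coloring of G, and let e₀ be an uncolored edge. Then there exists a partial (Δ+μ)-edge coloring χ′ of G whose set of colored edges is exactly the set of edges colored by χ together with e₀. -/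
/-- A partial `κ`-edge coloring of a multigraph given by an endpoint map `ends : E → Sym2 V`:
edges may be uncolored (`none`), and any two distinct colored edges sharing an endpoint —
including parallel edges — receive distinct colors. -/
def IsPartialEdgeColoringM {V E : Type*} (ends : E → Sym2 V) {κ : ℕ}
    (χ : E → Option (Fin κ)) : Prop :=
  ∀ e f : E, e ≠ f → (∃ v : V, v ∈ ends e ∧ v ∈ ends f) →
    χ e ≠ none → χ f ≠ none → χ e ≠ χ f

section MultigraphVizing

variable {V E : Type*} {ends : E → Sym2 V} {κ : ℕ} {χ : E → Option (Fin κ)}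

/-- The color `c` is missing at the vertex `v`: no edge at `v` has color `c`. -/
def IsMissingAt (ends : E → Sym2 V) (χ : E → Option (Fin κ)) (v : V) (c : Fin κ) : Prop :=
  ∀ e : E, v ∈ ends e → χ e ≠ some c

/-- `FanReach ends χ x y n v`: the vertex `v` is reached from `y` in `n` steps of a fan centered
at `x`, where a step from `w` to `u` is an edge between `x` and `u` whose color is missing
at `w`. -/
def FanReach (ends : E → Sym2 V) (χ : E → Option (Fin κ)) (x y : V) : ℕ → V → Prop
  | 0, v => v = y
  | n + 1, v => ∃ (w : V) (f : E) (c : Fin κ), FanReach ends χ x y n w ∧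
      ends f = s(x, v) ∧ χ f = some c ∧ IsMissingAt ends χ w c

/-- The simple graph on `V` whose edges are the pairs of vertices joined by an edge of
color `a` or `b`. -/
def kempeGraph (ends : E → Sym2 V) (χ : E → Option (Fin κ)) (a b : Fin κ) : SimpleGraph V where
  Adj u v := u ≠ v ∧ ∃ e, ends e = s(u, v) ∧ (χ e = some a ∨ χ e = some b)
  symm := ⟨fun _ _ ⟨h, e, he, hc⟩ => ⟨h.symm, e, he.trans Sym2.eq_swap, hc⟩⟩
  loopless := ⟨fun _ h => h.1 rfl⟩

theorem IsPartialEdgeColoringM.eq_of_color_eq (hχ : IsPartialEdgeColoringM ends χ) {e f : E}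
    {v : V} {c : Fin κ} (hve : v ∈ ends e) (hvf : v ∈ ends f) (he : χ e = some c)
    (hf : χ f = some c) : e = f := by
  by_contra h
  exact hχ e f h ⟨v, hve, hvf⟩ (by simp [he]) (by simp [hf]) (he.trans hf.symm)

open Classical in
theorem IsPartialEdgeColoringM.update (hχ : IsPartialEdgeColoringM ends χ) {e : E} {x y : V}
    (he : ends e = s(x, y)) {c : Fin κ} (hx : IsMissingAt ends χ x c)
    (hy : IsMissingAt ends χ y c) :
    IsPartialEdgeColoringM ends (Function.update χ e (some c)) := by
  have key : ∀ f v, v ∈ ends e → v ∈ ends f → χ f ≠ some c := by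
    intro f v hv hvf
    rw [he, Sym2.mem_iff] at hv
    rcases hv with rfl | rfl
    exacts [hx f hvf, hy f hvf]
  rintro f g hfg ⟨v, hvf, hvg⟩ hf hg
  by_cases h1 : f = e
  · subst h1
    rw [Function.update_self, Function.update_of_ne (Ne.symm hfg)]
    exact (key g v hvf hvg).symm
  · by_cases h2 : g = e
    · subst h2
      rw [Function.update_self, Function.update_of_ne h1]
      exact key f v hvg hvf
    · rw [Function.update_of_ne h1] at hf ⊢
      rw [Function.update_of_ne h2] at hg ⊢
      exact hχ f g hfg ⟨v, hvf, hvg⟩ hf hg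

open Classical in
/-- If a vertex reached by the fan shares a missing color with the center, then the coloring
extends to the uncolored edge. -/
theorem FanReach.exists_extension {e₀ : E} {x y : V} (he₀ : ends e₀ = s(x, y))
    (n : ℕ) : ∀ (χ : E → Option (Fin κ)) (z : V) (c : Fin κ), IsPartialEdgeColoringM ends χ →
    χ e₀ = none → FanReach ends χ x y n z → IsMissingAt ends χ x c → IsMissingAt ends χ z c →
    ∃ χ' : E → Option (Fin κ), IsPartialEdgeColoringM ends χ' ∧
      {e : E | χ' e ≠ none} = insert e₀ {e : E | χ e ≠ none} := by
  induction n using Nat.strong_induction_on with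
  | _ n ih =>
  intro χ z c hχ hunc hz hxc hzc
  by_cases hmin : ∃ m < n, FanReach ends χ x y m z
  · obtain ⟨m, hm, hmz⟩ := hmin
    exact ih m hm χ z c hχ hunc hmz hxc hzc
  push Not at hmin
  cases n with
  | zero =>
    obtain rfl : z = y := hz
    refine ⟨_, hχ.update he₀ hxc hzc, ?_⟩
    ext f
    by_cases hf : f = e₀ <;> simp [hf]
  | succ k =>
    obtain ⟨w, f, d, hw, hf, hfd, hwd⟩ := hz
    have hxf : x ∈ ends f := by simp [hf]
    have hzf : z ∈ ends f := by simp [hf]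
    have hcd : c ≠ d := fun h => hxc f hxf (h ▸ hfd)
    have hwf : w ∉ ends f := fun h => hwd f h hfd
    have hf₀ : e₀ ≠ f := by rintro rfl; simp [hunc] at hfd
    have hdom : {e : E | Function.update χ f (some c) e ≠ none} = {e : E | χ e ≠ none} := by
      ext g
      by_cases hg : g = f <;> simp [hg, hfd]
    have hmiss : ∀ v c', c' ≠ c → IsMissingAt ends χ v c' →
        IsMissingAt ends (Function.update χ f (some c)) v c' := by
      intro v c' hc' hv g hg
      by_cases h : g = f
      · simp [h, hc'.symm]
      · rw [Function.update_of_ne h]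
        exact hv g hg
    have hreach : ∀ m ≤ k, ∀ v, FanReach ends χ x y m v →
        FanReach ends (Function.update χ f (some c)) x y m v := by
      intro m
      induction m with
      | zero => exact fun _ v hv => hv
      | succ m ihm =>
        rintro hm v ⟨u, g, c', hu, hg, hgc, huc⟩
        have hgf : g ≠ f := by
          rintro rfl
          have : v = z := Sym2.congr_right.mp (hg.symm.trans hf)
          exact hmin (m + 1) (by omega) (this ▸ ⟨u, g, c', hu, hg, hgc, huc⟩)
        refine ⟨u, g, c', ihm (by omega) u hu, hg, by rwa [Function.update_of_ne hgf], ?_⟩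
        refine hmiss u c' ?_ huc
        rintro rfl
        exact hxc g (by simp [hg]) hgc
    have hxd : IsMissingAt ends (Function.update χ f (some c)) x d := by
      intro g hg
      by_cases h : g = f
      · simp [h, hcd]
      · rw [Function.update_of_ne h]
        exact fun hgd => h (hχ.eq_of_color_eq hg hxf hgd hfd)
    rw [← hdom]
    exact ih k (by omega) _ w d (hχ.update hf hxc hzc) (by rwa [Function.update_of_ne hf₀])
      (hreach k le_rfl w hw) hxd (hmiss w d hcd.symm hwd)

open Classical in
/-- Exchange the colors `a` and `b` on the edges meeting the vertex set `C`. -/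
noncomputable def kempeSwap (ends : E → Sym2 V) (χ : E → Option (Fin κ)) (a b : Fin κ)
    (C : Set V) (e : E) : Option (Fin κ) :=
  if ∃ v ∈ ends e, v ∈ C then (χ e).map (Equiv.swap a b) else χ e

theorem kempeSwap_eq_none_iff {a b : Fin κ} {C : Set V} {e : E} :
    kempeSwap ends χ a b C e = none ↔ χ e = none := by
  unfold kempeSwap
  split_ifs <;> simp

theorem kempeSwap_of_mem {a b : Fin κ} {C : Set V} {e : E} {v : V} (hve : v ∈ ends e)
    (hv : v ∈ C) : kempeSwap ends χ a b C e = (χ e).map (Equiv.swap a b) :=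
  if_pos ⟨v, hve, hv⟩

theorem kempeSwap_of_notMem {a b : Fin κ} {C : Set V}
    (hC : ∀ e, χ e = some a ∨ χ e = some b → ∀ u ∈ ends e, ∀ v ∈ ends e, u ∈ C → v ∈ C)
    {e : E} {v : V} (hve : v ∈ ends e) (hv : v ∉ C) : kempeSwap ends χ a b C e = χ e := by
  unfold kempeSwap
  split_ifs with h
  · obtain ⟨u, hue, hu⟩ := h
    cases hc : χ e with
    | none => rfl
    | some c =>
      have hne : ¬ (χ e = some a ∨ χ e = some b) := fun h => hv (hC e h u hue v hve hu)
      rw [hc, Option.some_inj, Option.some_inj, not_or] at hne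
      rw [Option.map_some, Equiv.swap_apply_of_ne_of_ne hne.1 hne.2]
  · rfl

theorem IsPartialEdgeColoringM.kempeSwap (hχ : IsPartialEdgeColoringM ends χ) {a b : Fin κ}
    {C : Set V}
    (hC : ∀ e, χ e = some a ∨ χ e = some b → ∀ u ∈ ends e, ∀ v ∈ ends e, u ∈ C → v ∈ C) :
    IsPartialEdgeColoringM ends (kempeSwap ends χ a b C) := by
  rintro e f hef ⟨v, hve, hvf⟩ he hf
  have h := hχ e f hef ⟨v, hve, hvf⟩ (mt kempeSwap_eq_none_iff.mpr he)
    (mt kempeSwap_eq_none_iff.mpr hf)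
  by_cases hv : v ∈ C
  · rw [kempeSwap_of_mem hve hv, kempeSwap_of_mem hvf hv]
    exact fun h' => h (Option.map_injective (Equiv.injective _) h')
  · rwa [kempeSwap_of_notMem hC hve hv, kempeSwap_of_notMem hC hvf hv]

theorem IsMissingAt.kempeSwap_of_mem {a b c : Fin κ} {C : Set V} {v : V}
    (h : IsMissingAt ends χ v c) (hv : v ∈ C) :
    IsMissingAt ends (kempeSwap ends χ a b C) v (Equiv.swap a b c) := by
  intro e he
  rw [_root_.kempeSwap_of_mem he hv, ← Option.map_some]
  exact fun h' => h e he (Option.map_injective (Equiv.injective _) h')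

theorem IsMissingAt.kempeSwap_of_notMem {a b c : Fin κ} {C : Set V} {v : V}
    (hC : ∀ e, χ e = some a ∨ χ e = some b → ∀ u ∈ ends e, ∀ v ∈ ends e, u ∈ C → v ∈ C)
    (h : IsMissingAt ends χ v c) (hv : v ∉ C) :
    IsMissingAt ends (kempeSwap ends χ a b C) v c := by
  intro e he
  rw [_root_.kempeSwap_of_notMem hC he hv]
  exact h e he

theorem kempeGraph_reachable_of_mem {a b : Fin κ} {e : E} (he : χ e = some a ∨ χ e = some b)
    {u v : V} (hu : u ∈ ends e) (hv : v ∈ ends e) : (kempeGraph ends χ a b).Reachable u v := by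
  by_cases huv : u = v
  · rw [huv]
  · exact SimpleGraph.Adj.reachable ⟨huv, e, (Sym2.mem_and_mem_iff huv).mp ⟨hu, hv⟩, he⟩

/-- If the coloring does not extend, then a fan vertex missing `b` lies on the same
`a`-`b`-chain as the center missing `a`. -/
theorem FanReach.reachable_kempeGraph {e₀ : E} {x y : V} (he₀ : ends e₀ = s(x, y))
    (hχ : IsPartialEdgeColoringM ends χ) (hunc : χ e₀ = none)
    (hno : ¬ ∃ χ' : E → Option (Fin κ), IsPartialEdgeColoringM ends χ' ∧
      {e : E | χ' e ≠ none} = insert e₀ {e : E | χ e ≠ none})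
    {n : ℕ} {z : V} (hz : FanReach ends χ x y n z) {a b : Fin κ}
    (hxa : IsMissingAt ends χ x a) (hzb : IsMissingAt ends χ z b) :
    (kempeGraph ends χ a b).Reachable z x := by
  by_contra hzx
  set C : Set V := {v | (kempeGraph ends χ a b).Reachable z v}
  have hC : ∀ e, χ e = some a ∨ χ e = some b →
      ∀ u ∈ ends e, ∀ v ∈ ends e, u ∈ C → v ∈ C :=
    fun e he u hu v hv huC => SimpleGraph.Reachable.trans huC (kempeGraph_reachable_of_mem he hu hv)
  have hx : x ∉ C := hzx
  have hzC : z ∈ C := SimpleGraph.Reachable.refl z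
  have hdom : {e : E | kempeSwap ends χ a b C e ≠ none} = {e : E | χ e ≠ none} := by
    ext e
    exact not_congr kempeSwap_eq_none_iff
  have hfin : ¬ ∃ m u, FanReach ends (kempeSwap ends χ a b C) x y m u ∧
      IsMissingAt ends (kempeSwap ends χ a b C) u a := by
    rintro ⟨m, u, hu, hua⟩
    rw [← hdom] at hno
    exact hno (FanReach.exists_extension he₀ m _ u a (hχ.kempeSwap hC)
      (kempeSwap_eq_none_iff.mpr hunc) hu (hxa.kempeSwap_of_notMem hC hx) hua)
  have hb : ∀ v ∈ C, IsMissingAt ends χ v b →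
      IsMissingAt ends (kempeSwap ends χ a b C) v a := fun v hv h => by
    simpa using h.kempeSwap_of_mem (a := a) (b := b) hv
  have hreach : ∀ m v, FanReach ends χ x y m v →
      FanReach ends (kempeSwap ends χ a b C) x y m v := by
    intro m
    induction m with
    | zero => exact fun v hv => hv
    | succ m ih =>
      rintro v ⟨w, f, c, hw, hf, hfc, hwc⟩
      have hxf : x ∈ ends f := by simp [hf]
      refine ⟨w, f, c, ih w hw, hf, (kempeSwap_of_notMem hC hxf hx).trans hfc, ?_⟩
      by_cases hwC : w ∈ C
      · have hca : c ≠ a := by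
          rintro rfl
          exact hxa f hxf hfc
        have hcb : c ≠ b := by
          rintro rfl
          exact hfin ⟨m, w, ih w hw, hb w hwC hwc⟩
        simpa [Equiv.swap_apply_of_ne_of_ne hca hcb] using
          hwc.kempeSwap_of_mem (a := a) (b := b) hwC
      · exact hwc.kempeSwap_of_notMem hC hwC
  exact hfin ⟨n, z, hreach n z hz, hb z hzC hzb⟩

/-- A finite connected graph of maximum degree at most two has at most two vertices of degree
at most one. -/
theorem SimpleGraph.Connected.not_three_degree_le_one {W : Type*} [Fintype W] {G : SimpleGraph W}
    [DecidableRel G.Adj] (hG : G.Connected) (hdeg : ∀ v, G.degree v ≤ 2) {p q r : W}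
    (hpq : p ≠ q) (hpr : p ≠ r) (hqr : q ≠ r) (hp : G.degree p ≤ 1) (hq : G.degree q ≤ 1)
    (hr : G.degree r ≤ 1) : False := by
  classical
  have h1 := hG.card_vert_le_card_edgeSet_add_one
  rw [Nat.card_eq_fintype_card, Nat.card_eq_fintype_card, ← SimpleGraph.edgeFinset_card] at h1
  have h2 := G.sum_degrees_eq_twice_card_edges
  have h3 : ∑ v, (G.degree v + if v ∈ ({p, q, r} : Finset W) then 1 else 0) ≤ ∑ _v : W, 2 := by
    refine Finset.sum_le_sum fun v _ => ?_
    split_ifs with hv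
    · simp only [Finset.mem_insert, Finset.mem_singleton] at hv
      rcases hv with rfl | rfl | rfl <;> omega
    · exact hdeg v
  have h4 : ({p, q, r} : Finset W).card = 3 := Finset.card_eq_three.mpr ⟨p, q, r, hpq, hpr, hqr, rfl⟩
  rw [Finset.sum_add_distrib, Finset.sum_ite_mem, Finset.univ_inter] at h3
  simp only [Finset.sum_const, Finset.card_univ, smul_eq_mul, h4] at h3
  omega

theorem IsPartialEdgeColoringM.degree_induce_kempeGraph_le
    (hχ : IsPartialEdgeColoringM ends χ) {a b : Fin κ} (s : Set V) (v : s)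
    [Fintype (((kempeGraph ends χ a b).induce s).neighborSet v)] (T : Finset (Fin κ))
    (hT : ∀ e, v.1 ∈ ends e → ∀ c, χ e = some c → c = a ∨ c = b → c ∈ T) :
    ((kempeGraph ends χ a b).induce s).degree v ≤ T.card := by
  have hex : ∀ w : s, ((kempeGraph ends χ a b).induce s).Adj v w →
      ∃ c ∈ T, ∃ e, ends e = s(v.1, w.1) ∧ χ e = some c := by
    rintro w ⟨-, e, he, hc | hc⟩
    · exact ⟨a, hT e (by simp [he]) a hc (Or.inl rfl), e, he, hc⟩
    · exact ⟨b, hT e (by simp [he]) b hc (Or.inr rfl), e, he, hc⟩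
  have : Nonempty (Fin κ) := ⟨a⟩
  choose! g hgT hg using hex
  rw [← SimpleGraph.card_neighborFinset_eq_degree]
  refine Finset.card_le_card_of_injOn g (fun w hw => hgT w (by simpa using hw)) ?_
  intro w hw u hu hwu
  obtain ⟨e, he, hec⟩ := hg w (by simpa using hw)
  obtain ⟨f, hf, hfc⟩ := hg u (by simpa using hu)
  have hef : e = f := hχ.eq_of_color_eq (v := v.1) (by simp [he]) (by simp [hf]) hec
    (hfc.trans (by rw [hwu]))
  subst hef
  exact Subtype.ext (Sym2.congr_right.mp (he.symm.trans hf))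

theorem IsPartialEdgeColoringM.not_three_reachable_kempeGraph [Finite V]
    (hχ : IsPartialEdgeColoringM ends χ) {a b : Fin κ} {x z w : V} (hzx : z ≠ x) (hwx : w ≠ x)
    (hzw : z ≠ w) (hz : (kempeGraph ends χ a b).Reachable z x)
    (hw : (kempeGraph ends χ a b).Reachable w x) (hxa : IsMissingAt ends χ x a)
    (hzb : IsMissingAt ends χ z b) (hwb : IsMissingAt ends χ w b) : False := by
  classical
  have := Fintype.ofFinite V
  let K := (kempeGraph ends χ a b).connectedComponentMk x
  have hzK : z ∈ K.supp := SimpleGraph.ConnectedComponent.sound hz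
  have hwK : w ∈ K.supp := SimpleGraph.ConnectedComponent.sound hw
  have hxK : x ∈ K.supp := rfl
  have hone : ∀ (v : K.supp) (c d : Fin κ), IsMissingAt ends χ v.1 c →
      (∀ c', c' = a ∨ c' = b → c' = c ∨ c' = d) →
      ((kempeGraph ends χ a b).induce K.supp).degree v ≤ 1 := by
    intro v c d hv hcd
    refine hχ.degree_induce_kempeGraph_le K.supp v {d} fun e he c' hc' h => ?_
    rcases hcd c' h with rfl | rfl
    · exact absurd hc' (hv e he)
    · simp
  have hconn : ((kempeGraph ends χ a b).induce K.supp).Connected := K.connected_toSimpleGraph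
  refine hconn.not_three_degree_le_one (fun v => ?_) (p := ⟨x, hxK⟩) (q := ⟨z, hzK⟩) (r := ⟨w, hwK⟩)
    (by simpa using hzx.symm) (by simpa using hwx.symm) (by simpa using hzw)
    (hone _ a b hxa fun _ h => h) (hone _ b a hzb fun _ h => h.symm)
    (hone _ b a hwb fun _ h => h.symm)
  refine (hχ.degree_induce_kempeGraph_le K.supp v {a, b} fun e _ c' _ h => ?_).trans
    Finset.card_le_two
  simpa using h

open Classical in
/-- The number of missing colors at a vertex plus the number of colored edges there is at
least the number of colors. -/
theorem le_card_missing_add [Fintype E] (ends : E → Sym2 V) (χ : E → Option (Fin κ)) (v : V) :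
    κ ≤ (Finset.univ.filter fun c => IsMissingAt ends χ v c).card +
      (Finset.univ.filter fun e => v ∈ ends e ∧ χ e ≠ none).card := by
  have hle : (Finset.univ.filter fun c => ¬ IsMissingAt ends χ v c).card ≤
      (Finset.univ.filter fun e => v ∈ ends e ∧ χ e ≠ none).card := by
    rw [← Finset.card_image_of_injective _ (Option.some_injective (Fin κ))]
    refine (Finset.card_le_card (t := (Finset.univ.filter fun e =>
      v ∈ ends e ∧ χ e ≠ none).image χ) fun o ho => ?_).trans Finset.card_image_le
    obtain ⟨c, hc, rfl⟩ := Finset.mem_image.mp ho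
    obtain ⟨e, hve, hec⟩ : ∃ e, v ∈ ends e ∧ χ e = some c := by simpa [IsMissingAt] using hc
    exact Finset.mem_image.mpr ⟨e, by simp [hve, hec], hec⟩
  have h := Finset.card_filter_add_card_filter_not (s := (Finset.univ : Finset (Fin κ)))
    (fun c => IsMissingAt ends χ v c)
  rw [Finset.card_univ, Fintype.card_fin] at h
  omega

end MultigraphVizing

/-- **One-edge color extension for Vizing's theorem on multigraphs**: any partial
`(Δ+μ)`-edge coloring of a finite loopless multigraph with maximum degree `Δ` and maximum
multiplicity `μ` can be extended to any given uncolored edge `e₀`, possibly recoloring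
other edges, without uncoloring any edge. -/
theorem vizing_multigraph_extend_one_edge {V E : Type*} [Fintype V] [Fintype E]
    (ends : E → Sym2 V) (hloopless : ∀ e : E, ¬ (ends e).IsDiag)
    (Δ μ : ℕ)
    (hΔ : ∀ v : V, Nat.card {e : E // v ∈ ends e} ≤ Δ)
    (hμ : ∀ p : Sym2 V, Nat.card {e : E // ends e = p} ≤ μ)
    (χ : E → Option (Fin (Δ + μ))) (hχ : IsPartialEdgeColoringM ends χ)
    (e₀ : E) (hunc : χ e₀ = none) :
    ∃ χ' : E → Option (Fin (Δ + μ)), IsPartialEdgeColoringM ends χ' ∧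
      {e : E | χ' e ≠ none} = insert e₀ {e : E | χ e ≠ none} := by
  classical
  by_contra hno
  obtain ⟨⟨x, y⟩, hxy⟩ := Sym2.mk_surjective (ends e₀)
  have he₀ : ends e₀ = s(x, y) := hxy.symm
  have hΔ' : ∀ v, (Finset.univ.filter fun e => v ∈ ends e).card ≤ Δ := by
    intro v
    simpa [Nat.card_eq_fintype_card, Fintype.card_subtype] using hΔ v
  have hmiss : ∀ v, μ ≤ (Finset.univ.filter fun c => IsMissingAt ends χ v c).card := by
    intro v
    have h1 := le_card_missing_add ends χ v
    have h2 : (Finset.univ.filter fun e => v ∈ ends e ∧ χ e ≠ none).card ≤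
        (Finset.univ.filter fun e => v ∈ ends e).card :=
      Finset.card_le_card fun e he => by simp at he ⊢; exact he.1
    have h3 := hΔ' v
    omega
  have hmiss₀ : ∀ v ∈ ends e₀,
      μ < (Finset.univ.filter fun c => IsMissingAt ends χ v c).card := by
    intro v hv
    have h1 := le_card_missing_add ends χ v
    have h2 : (Finset.univ.filter fun e => v ∈ ends e ∧ χ e ≠ none).card <
        (Finset.univ.filter fun e => v ∈ ends e).card := by
      refine Finset.card_lt_card (Finset.ssubset_iff_of_subset ?_ |>.mpr ⟨e₀, ?_, ?_⟩)
      · exact fun e he => by simp at he ⊢; exact he.1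
      · simpa using hv
      · simp [hunc]
    have h3 := hΔ' v
    omega
  obtain ⟨a, ha⟩ := Finset.card_pos.mp ((Nat.zero_le μ).trans_lt (hmiss₀ x (by simp [he₀])))
  have hxa : IsMissingAt ends χ x a := by simpa using ha
  have hfan : ∀ n v c, FanReach ends χ x y n v → IsMissingAt ends χ v c →
      ¬ IsMissingAt ends χ x c := fun n v c hv hvc hxc =>
    hno (FanReach.exists_extension he₀ n χ v c hχ hunc hv hxc hvc)
  have hne : ∀ n v, FanReach ends χ x y n v → v ≠ x := by
    rintro n v hv rfl
    have hloop : ∀ e, ends e ≠ s(v, v) := fun e h => hloopless e (by simp [h])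
    cases n with
    | zero => exact hloop e₀ (he₀.trans (by rw [show v = y from hv]))
    | succ n =>
      obtain ⟨w, f, c, -, hf, -⟩ := hv
      exact hloop f hf
  let Z : Finset V := Finset.univ.filter fun v => ∃ n, FanReach ends χ x y n v
  let M : V → Finset (Fin (Δ + μ)) := fun v => Finset.univ.filter fun c => IsMissingAt ends χ v c
  have hyZ : y ∈ Z := by
    simp only [Z, Finset.mem_filter, Finset.mem_univ, true_and]
    exact ⟨0, rfl⟩
  have hdisj : (Z : Set V).PairwiseDisjoint M := by
    intro z hz w hw hzw
    obtain ⟨n, hn⟩ : ∃ n, FanReach ends χ x y n z := by simpa [Z] using hz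
    obtain ⟨m, hm⟩ : ∃ n, FanReach ends χ x y n w := by simpa [Z] using hw
    refine Finset.disjoint_left.mpr fun b hzb hwb => ?_
    have hzb' : IsMissingAt ends χ z b := by simpa [M] using hzb
    have hwb' : IsMissingAt ends χ w b := by simpa [M] using hwb
    exact hχ.not_three_reachable_kempeGraph (hne n z hn) (hne m w hm) hzw
      (hn.reachable_kempeGraph he₀ hχ hunc hno hxa hzb')
      (hm.reachable_kempeGraph he₀ hχ hunc hno hxa hwb') hxa hzb' hwb'
  have hlow : μ * Z.card < (Z.biUnion M).card := by
    rw [Finset.card_biUnion hdisj, mul_comm, ← smul_eq_mul, ← Finset.sum_const]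
    exact Finset.sum_lt_sum (fun v _ => hmiss v) ⟨y, hyZ, hmiss₀ y (by simp [he₀])⟩
  let F : Finset E := Z.biUnion fun v => Finset.univ.filter fun e => ends e = s(x, v)
  have hF : F.card ≤ Z.card * μ := by
    refine Finset.card_biUnion_le_card_mul _ _ _ fun v _ => ?_
    simpa [Nat.card_eq_fintype_card, Fintype.card_subtype] using hμ s(x, v)
  have hex : ∀ c ∈ Z.biUnion M, ∃ e ∈ F, χ e = some c := by
    intro c hc
    obtain ⟨v, hv, hvc⟩ := Finset.mem_biUnion.mp hc
    obtain ⟨n, hn⟩ : ∃ n, FanReach ends χ x y n v := by simpa [Z] using hv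
    have hvc' : IsMissingAt ends χ v c := by simpa [M] using hvc
    obtain ⟨e, hxe, hec⟩ : ∃ e, x ∈ ends e ∧ χ e = some c := by
      simpa [IsMissingAt] using hfan n v c hn hvc'
    obtain ⟨u, hu⟩ := Sym2.mem_iff_exists.mp hxe
    refine ⟨e, Finset.mem_biUnion.mpr ⟨u, ?_, by simpa using hu⟩, hec⟩
    simp only [Z, Finset.mem_filter, Finset.mem_univ, true_and]
    exact ⟨n + 1, v, e, c, hn, hu, hec, hvc'⟩
  have : Nonempty E := ⟨e₀⟩
  choose! g hgF hg using hex
  have hup : (Z.biUnion M).card ≤ F.card := by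
    refine Finset.card_le_card_of_injOn g hgF fun c hc d hd hcd => ?_
    have h1 := hg c hc
    rw [hcd, hg d hd] at h1
    exact (Option.some.inj h1).symm
  rw [mul_comm] at hF
  omega
end

section
/- Let G be a finite simple bipartite undirected graph with maximum degree Δ, let χ be a partial Δ-edge coloring of G, and let e₀ be an uncolored edge. Then there exists a partial Δ-edge coloring χ′ of G whose set of colored edges is exactly the set of edges colored by χ together with e₀. -/
/-- The colored edges at a vertex are determined by their color. -/
theorem IsPartialEdgeColoring.eq_of_color_eq {V : Type*} {G : SimpleGraph V} {κ : ℕ}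
    {χ : Sym2 V → Option (Fin κ)} (hχ : IsPartialEdgeColoring G χ) {x y z : V} {c : Fin κ}
    (hy : G.Adj x y) (hz : G.Adj x z) (hcy : χ s(x, y) = some c) (hcz : χ s(x, z) = some c) :
    y = z := by
  by_contra hne
  exact hχ s(x, y) hy s(x, z) hz (mt Sym2.congr_right.1 hne) ⟨x, by simp, by simp⟩
    (by simp [hcy]) (by simp [hcz]) (hcy.trans hcz.symm)

/-- An endpoint of degree at most `κ` of an uncolored edge misses some color. -/
theorem exists_missing_color {V : Type*} [Fintype V] (G : SimpleGraph V) [DecidableRel G.Adj]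
    {κ : ℕ} (χ : Sym2 V → Option (Fin κ)) {u v : V} (hdeg : G.degree u ≤ κ)
    (huv : G.Adj u v) (hunc : χ s(u, v) = none) :
    ∃ a : Fin κ, ∀ y, G.Adj u y → χ s(u, y) ≠ some a := by
  classical
  by_contra! h
  choose y hadj hcol using h
  have hinj : Function.Injective y := fun c d hcd =>
    Option.some.inj ((hcol c).symm.trans (hcd ▸ hcol d))
  have hsub : Finset.univ.image y ⊆ (G.neighborFinset u).erase v := by
    intro w hw
    obtain ⟨c, -, rfl⟩ := Finset.mem_image.1 hw
    refine Finset.mem_erase.2 ⟨fun hv => ?_, by simpa using hadj c⟩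
    have hc := hcol c
    rw [hv, hunc] at hc
    cases hc
  have hcard := Finset.card_le_card hsub
  have hv : v ∈ G.neighborFinset u := by simpa using huv
  have hpos := Finset.card_pos.2 ⟨v, hv⟩
  rw [Finset.card_image_of_injective _ hinj, Finset.card_erase_of_mem hv] at hcard
  simp only [Finset.card_univ, Fintype.card_fin, SimpleGraph.card_neighborFinset_eq_degree]
    at hcard hpos
  omega

/-- If `u` misses `a` and `v` misses `b`, where `u` and `v` are adjacent in a bipartite graph,
then some set of vertices that is closed under edges colored `a` or `b` contains `v` but
not `u`. -/
theorem exists_closed_set_separating {V : Type*} {G : SimpleGraph V} (hbip : G.Colorable 2)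
    {κ : ℕ} {χ : Sym2 V → Option (Fin κ)} (hχ : IsPartialEdgeColoring G χ) {u v : V}
    (huv : G.Adj u v) {a b : Fin κ} (ha : ∀ y, G.Adj u y → χ s(u, y) ≠ some a)
    (hb : ∀ y, G.Adj v y → χ s(v, y) ≠ some b) :
    ∃ S : Set V, v ∈ S ∧ u ∉ S ∧ ∀ x ∈ S, ∀ y, G.Adj x y →
      χ s(x, y) = some a ∨ χ s(x, y) = some b → y ∈ S := by
  classical
  obtain ⟨C⟩ := hbip
  have hside : ∀ {x y}, G.Adj x y → (C y = C v ↔ C x ≠ C v) := by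
    intro x y hxy
    have := C.valid hxy
    omega
  let R : V → V → Prop := fun x y =>
    G.Adj x y ∧ χ s(x, y) = some (if C x = C v then a else b)
  refine ⟨{x | Relation.ReflTransGen R v x}, .refl, fun hu => ?_, fun x hx y hxy hcol => ?_⟩
  · rcases Relation.ReflTransGen.cases_tail hu with rfl | ⟨y, -, hyu, hcol⟩
    · exact huv.ne rfl
    · have hy : C y = C v := (hside hyu.symm).2 (C.valid huv)
      rw [if_pos hy, Sym2.eq_swap] at hcol
      exact ha y hyu.symm hcol
  · by_cases hstep : χ s(x, y) = some (if C x = C v then a else b)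
    · exact Relation.ReflTransGen.tail hx ⟨hxy, hstep⟩
    · have hback : χ s(x, y) = some (if C x = C v then b else a) := by
        split_ifs at hstep ⊢ <;> tauto
      rcases Relation.ReflTransGen.cases_tail hx with rfl | ⟨z, hz, hzx, hcol'⟩
      · rw [if_pos rfl] at hback
        exact absurd hback (hb y hxy)
      · have hcz : χ s(x, z) = some (if C x = C v then b else a) := by
          rw [Sym2.eq_swap, hcol']
          have := hside hzx
          split_ifs <;> tauto
        exact hχ.eq_of_color_eq hxy hzx.symm hback hcz ▸ hz

/-- **One-edge color extension in bipartite graphs**: any partial `Δ`-edge coloring of a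
finite simple bipartite graph with maximum degree `Δ` can be extended to any given uncolored
edge `e₀`, possibly recoloring other edges, without uncoloring any edge. -/
theorem bipartite_extend_one_edge {V : Type*} [Fintype V] (G : SimpleGraph V)
    [DecidableRel G.Adj] (hbip : G.Colorable 2)
    (Δ : ℕ) (hΔ : ∀ v : V, G.degree v ≤ Δ)
    (χ : Sym2 V → Option (Fin Δ)) (hχ : IsPartialEdgeColoring G χ)
    (e₀ : Sym2 V) (he₀ : e₀ ∈ G.edgeSet) (hunc : χ e₀ = none) :
    ∃ χ' : Sym2 V → Option (Fin Δ), IsPartialEdgeColoring G χ' ∧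
      {e : Sym2 V | e ∈ G.edgeSet ∧ χ' e ≠ none} =
        insert e₀ {e : Sym2 V | e ∈ G.edgeSet ∧ χ e ≠ none} := by
  classical
  induction e₀ with | h u v => ?_
  have huv : G.Adj u v := he₀
  obtain ⟨a, ha⟩ := exists_missing_color G χ (hΔ u) huv hunc
  obtain ⟨b, hb⟩ := exists_missing_color G χ (hΔ v) huv.symm (Sym2.eq_swap ▸ hunc)
  obtain ⟨S, hvS, huS, hS⟩ := exists_closed_set_separating hbip hχ huv ha hb
  let σ : Sym2 V → Option (Fin Δ) := fun e =>
    if ∃ x ∈ e, x ∈ S then (χ e).map (Equiv.swap a b) else χ e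
  have hσ_in : ∀ e, ∀ w ∈ e, w ∈ S → σ e = (χ e).map (Equiv.swap a b) :=
    fun e w hw hwS => if_pos ⟨w, hw, hwS⟩
  have hσ_out : ∀ e ∈ G.edgeSet, ∀ w ∈ e, w ∉ S → σ e = χ e := by
    intro e he w hw hwS
    by_cases hex : ∃ x ∈ e, x ∈ S
    · obtain ⟨x, hx, hxS⟩ := hex
      have hxw : x ≠ w := fun h => hwS (h ▸ hxS)
      obtain rfl := (Sym2.mem_and_mem_iff hxw).1 ⟨hx, hw⟩
      have hab := mt (hS x hxS w he) hwS
      rw [hσ_in _ x hx hxS]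
      cases hc : χ s(x, w) with
      | none => rfl
      | some c =>
        simp only [hc, Option.some.injEq, not_or] at hab
        simp [Equiv.swap_apply_of_ne_of_ne hab.1 hab.2]
    · exact if_neg hex
  have hσ_none : ∀ e, σ e = none ↔ χ e = none := by
    intro e
    simp only [σ]
    split_ifs <;> simp
  have hσ : IsPartialEdgeColoring G σ := by
    rintro e he f hf hef ⟨w, hwe, hwf⟩ hce hcf
    have hne := hχ e he f hf hef ⟨w, hwe, hwf⟩ (mt (hσ_none e).2 hce) (mt (hσ_none f).2 hcf)
    by_cases hw : w ∈ S
    · rw [hσ_in e w hwe hw, hσ_in f w hwf hw]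
      exact (Option.map_injective (Equiv.swap a b).injective).ne hne
    · rwa [hσ_out e he w hwe hw, hσ_out f hf w hwf hw]
  have hfree : ∀ f ∈ G.edgeSet, (∃ w, w ∈ s(u, v) ∧ w ∈ f) → σ f ≠ some a := by
    rintro f hf ⟨w, hw, hwf⟩ hcol
    obtain ⟨y, rfl⟩ := Sym2.mem_iff_exists.1 hwf
    rcases Sym2.mem_iff.1 hw with rfl | rfl
    · exact ha y hf (hσ_out _ hf w hwf huS ▸ hcol)
    · rw [hσ_in _ w hwf hvS, Option.map_eq_some_iff] at hcol
      obtain ⟨c, hc, hca⟩ := hcol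
      rw [Equiv.swap_apply_eq_iff, Equiv.swap_apply_left] at hca
      exact hb y hf (hca ▸ hc)
  refine ⟨Function.update σ s(u, v) (some a), ?_, ?_⟩
  · rintro e he f hf hef ⟨w, hwe, hwf⟩ hce hcf
    by_cases h₁ : e = s(u, v)
    · subst h₁
      rw [Function.update_self, Function.update_of_ne hef.symm]
      exact (hfree f hf ⟨w, hwe, hwf⟩).symm
    by_cases h₂ : f = s(u, v)
    · subst h₂
      rw [Function.update_self, Function.update_of_ne hef]
      exact hfree e he ⟨w, hwf, hwe⟩
    rw [Function.update_of_ne h₁] at hce ⊢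
    rw [Function.update_of_ne h₂] at hcf ⊢
    exact hσ e he f hf hef ⟨w, hwe, hwf⟩ hce hcf
  · ext e
    by_cases h : e = s(u, v)
    · subst h
      simpa using huv
    · simp [h, hσ_none]
end

section
/- Let χ be a partial κ-edge coloring of a finite simple undirected graph G, let α, β be distinct colors, and let P be a maximal {α,β}-alternating path in χ. Then the coloring χ′ obtained from χ by flipping P (recoloring every α-colored edge of P with β and every β-colored edge of P with α) is again a partial κ-edge coloring of G, and it colors exactly the same set of edges as χ. -/
/-- The color `c` is missing at the vertex `x`: no edge of `G` incident on `x` has color `c`. -/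
def MissingAt {V : Type*} (G : SimpleGraph V) {κ : ℕ}
    (χ : Sym2 V → Option (Fin κ)) (x : V) (c : Fin κ) : Prop :=
  ∀ e ∈ G.edgeSet, x ∈ e → χ e ≠ some c

/-- A walk `P` is an `{α,β}`-alternating path for the partial coloring `χ` if its successive
edges are colored `α, β, α, β, …` or `β, α, β, α, …`. -/
def IsAltPath {V : Type*} (G : SimpleGraph V) {κ : ℕ} (χ : Sym2 V → Option (Fin κ))
    (α β : Fin κ) {u v : V} (P : G.Walk u v) : Prop :=
  (∀ (i : ℕ) (h : i < P.edges.length),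
      χ (P.edges[i]'h) = some (if i % 2 = 0 then α else β)) ∨
  (∀ (i : ℕ) (h : i < P.edges.length),
      χ (P.edges[i]'h) = some (if i % 2 = 0 then β else α))

/-- An `{α,β}`-alternating path is maximal if at each of its endpoints at least one of the
colors `α`, `β` is missing. -/
def IsMaximalAltPath {V : Type*} (G : SimpleGraph V) {κ : ℕ} (χ : Sym2 V → Option (Fin κ))
    (α β : Fin κ) {u v : V} (P : G.Walk u v) : Prop :=
  IsAltPath G χ α β P ∧
    (MissingAt G χ u α ∨ MissingAt G χ u β) ∧
    (MissingAt G χ v α ∨ MissingAt G χ v β)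

/-- Flipping the path `P`: every `α`-colored edge of `P` is recolored `β` and every
`β`-colored edge of `P` is recolored `α`; all other edges are unchanged. -/
def flipPath {V : Type*} [DecidableEq V] (G : SimpleGraph V) {κ : ℕ}
    (χ : Sym2 V → Option (Fin κ)) (α β : Fin κ) {u v : V} (P : G.Walk u v) :
    Sym2 V → Option (Fin κ) :=
  fun e =>
    if e ∈ P.edges then
      if χ e = some α then some β else if χ e = some β then some α else χ e
    else χ e

/-- Every edge of an `{α,β}`-alternating path is colored `α` or `β`. -/
theorem IsAltPath.eq_or_eq_of_mem_edges {V : Type*} {G : SimpleGraph V} {κ : ℕ}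
    {χ : Sym2 V → Option (Fin κ)} {α β : Fin κ} {u v : V} {P : G.Walk u v}
    (h : IsAltPath G χ α β P) {e : Sym2 V} (he : e ∈ P.edges) :
    χ e = some α ∨ χ e = some β := by
  obtain ⟨i, hi, rfl⟩ := List.mem_iff_getElem.mp he
  rcases h with h | h <;> rw [h i hi] <;> split_ifs <;> simp

/-- Both colors of an alternating path occur at each of its internal vertices. -/
theorem IsAltPath.exists_mem_edges_of_internal {V : Type*} {G : SimpleGraph V} {κ : ℕ}
    {χ : Sym2 V → Option (Fin κ)} {α β : Fin κ} {u v : V} {P : G.Walk u v}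
    (h : IsAltPath G χ α β P) {x : V} (hx : x ∈ P.support) (hxu : x ≠ u) (hxv : x ≠ v)
    {c : Fin κ} (hc : c = α ∨ c = β) : ∃ g ∈ P.edges, x ∈ g ∧ χ g = some c := by
  obtain ⟨n, rfl, hn⟩ := SimpleGraph.Walk.mem_support_iff_exists_getVert.mp hx
  obtain _ | m := n
  · simp at hxu
  have hlt : m + 1 < P.length := lt_of_le_of_ne hn fun heq => hxv (by simp [heq])
  have h₁ : m < P.edges.length := by rw [P.length_edges]; omega
  have h₂ : m + 1 < P.edges.length := by rwa [P.length_edges]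
  have m₁ : P.getVert (m + 1) ∈ P.edges[m] := by simp [SimpleGraph.Walk.getElem_edges]
  have m₂ : P.getVert (m + 1) ∈ P.edges[m + 1] := by simp [SimpleGraph.Walk.getElem_edges]
  have key : χ P.edges[m] = some c ∨ χ P.edges[m + 1] = some c := by
    rcases h with h | h <;> rw [h m h₁, h (m + 1) h₂] <;> grind
  rcases key with hk | hk
  · exact ⟨_, List.getElem_mem h₁, m₁, hk⟩
  · exact ⟨_, List.getElem_mem h₂, m₂, hk⟩

/-- A maximal alternating path contains every `α`- or `β`-colored edge that touches one of its
edges. -/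
theorem IsMaximalAltPath.mem_edges_of_touching {V : Type*} {G : SimpleGraph V} {κ : ℕ}
    {χ : Sym2 V → Option (Fin κ)} (hχ : IsPartialEdgeColoring G χ) {α β : Fin κ}
    {u v : V} {P : G.Walk u v} (hmax : IsMaximalAltPath G χ α β P) {e f : Sym2 V} {x : V}
    (he : e ∈ P.edges) (hxe : x ∈ e) (hf : f ∈ G.edgeSet) (hxf : x ∈ f)
    (hc : χ f = some α ∨ χ f = some β) : f ∈ P.edges := by
  obtain ⟨halt, hu, hv⟩ := hmax
  have unique : ∀ g ∈ P.edges, x ∈ g → χ g = χ f → f ∈ P.edges := by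
    intro g hg hxg hgf
    by_cases hne : g = f
    · exact hne ▸ hg
    · have hf' : χ f ≠ none := by rcases hc with hc | hc <;> simp [hc]
      exact absurd hgf (hχ g (P.edges_subset_edgeSet hg) f hf hne ⟨x, hxg, hxf⟩
        (hgf ▸ hf') hf')
  have missing : (MissingAt G χ x α ∨ MissingAt G χ x β) → f ∈ P.edges := by
    intro hm
    refine unique e he hxe ?_
    have hce := halt.eq_or_eq_of_mem_edges he
    rcases hm with hm | hm <;>
      have h₁ := hm e (P.edges_subset_edgeSet he) hxe <;>
      have h₂ := hm f hf hxf <;> grind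
  by_cases hxu : x = u
  · exact missing (hxu ▸ hu)
  by_cases hxv : x = v
  · exact missing (hxv ▸ hv)
  have hx : x ∈ P.support := SimpleGraph.Walk.mem_support_of_mem_edges he hxe
  rcases hc with hc | hc
  · obtain ⟨g, hg, hxg, hgc⟩ := halt.exists_mem_edges_of_internal hx hxu hxv (Or.inl rfl)
    exact unique g hg hxg (hgc.trans hc.symm)
  · obtain ⟨g, hg, hxg, hgc⟩ := halt.exists_mem_edges_of_internal hx hxu hxv (Or.inr rfl)
    exact unique g hg hxg (hgc.trans hc.symm)

/-- Flipping a path does not change which edges are colored. -/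
theorem flipPath_eq_none_iff {V : Type*} [DecidableEq V] {G : SimpleGraph V} {κ : ℕ}
    {χ : Sym2 V → Option (Fin κ)} {α β : Fin κ} {u v : V} {P : G.Walk u v} {e : Sym2 V} :
    flipPath G χ α β P e = none ↔ χ e = none := by
  grind [flipPath]

/-- **Flipping a maximal alternating path preserves properness**: if `χ` is a partial
`κ`-edge coloring, `α ≠ β`, and `P` is a maximal `{α,β}`-alternating path, then the coloring
obtained by flipping `P` is again a partial `κ`-edge coloring, and it colors exactly the
same set of edges as `χ`. -/
theorem flip_maximal_alt_path {V : Type*} [Fintype V] [DecidableEq V]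
    (G : SimpleGraph V) {κ : ℕ} (χ : Sym2 V → Option (Fin κ))
    (hχ : IsPartialEdgeColoring G χ) (α β : Fin κ) (hαβ : α ≠ β)
    {u v : V} (P : G.Walk u v) (hP : P.IsPath)
    (hmax : IsMaximalAltPath G χ α β P) :
    IsPartialEdgeColoring G (flipPath G χ α β P) ∧
      {e : Sym2 V | e ∈ G.edgeSet ∧ flipPath G χ α β P e ≠ none} =
        {e : Sym2 V | e ∈ G.edgeSet ∧ χ e ≠ none} := by
  refine ⟨?_, by simp only [ne_eq, flipPath_eq_none_iff]⟩
  intro e he f hf hne ⟨x, hxe, hxf⟩ hce hcf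
  rw [ne_eq, flipPath_eq_none_iff] at hce hcf
  have hne' := hχ e he f hf hne ⟨x, hxe, hxf⟩ hce hcf
  have hef := fun h => hmax.mem_edges_of_touching hχ (e := e) (f := f) h hxe hf hxf
  have hfe := fun h => hmax.mem_edges_of_touching hχ (e := f) (f := e) h hxf he hxe
  have ce := fun h => hmax.1.eq_or_eq_of_mem_edges (e := e) h
  have cf := fun h => hmax.1.eq_or_eq_of_mem_edges (e := f) h
  grind [flipPath]
end

section
/- Let χ be a partial κ-edge coloring of a finite simple undirected graph G, let α, β be distinct colors, let P be a maximal {α,β}-alternating path in χ, and let χ′ be the coloring obtained from χ by flipping P. Then for every vertex z that is not an endpoint of P, miss_{χ′}(z) = miss_χ(z); that is, only the palettes of the two endpoints of P change. -/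
/-- An interior vertex of a walk lies on two consecutive edges of it. -/
theorem SimpleGraph.Walk.exists_consecutive_edges {V : Type*} {G : SimpleGraph V} {u v z : V}
    (P : G.Walk u v) (hz : z ∈ P.support) (hzu : z ≠ u) (hzv : z ≠ v) :
    ∃ (i : ℕ) (h : i + 1 < P.edges.length), z ∈ P.edges[i] ∧ z ∈ P.edges[i + 1] := by
  obtain ⟨n, rfl, hn⟩ := SimpleGraph.Walk.mem_support_iff_exists_getVert.1 hz
  obtain _ | i := n
  · simp at hzu
  · have hne : i + 1 ≠ P.length := by
      intro h
      rw [h] at hzv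
      simp at hzv
    refine ⟨i, by rw [SimpleGraph.Walk.length_edges]; omega, ?_, ?_⟩ <;>
      simp [SimpleGraph.Walk.getElem_edges]

/-- Both colors of an alternating path occur on its edges at each interior vertex. -/
theorem IsAltPath.exists_edges_at {V : Type*} {G : SimpleGraph V} {κ : ℕ}
    {χ : Sym2 V → Option (Fin κ)} {α β : Fin κ} {u v z : V} {P : G.Walk u v}
    (hP : IsAltPath G χ α β P) (hz : z ∈ P.support) (hzu : z ≠ u) (hzv : z ≠ v) :
    ∃ a ∈ P.edges, ∃ b ∈ P.edges, z ∈ a ∧ z ∈ b ∧ χ a = some α ∧ χ b = some β := by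
  obtain ⟨i, hi, h₀, h₁⟩ := P.exists_consecutive_edges hz hzu hzv
  have hm₀ := List.getElem_mem (Nat.lt_of_succ_lt hi)
  have hm₁ := List.getElem_mem hi
  rcases hP with hP | hP <;>
    have hc₀ := hP i (Nat.lt_of_succ_lt hi) <;>
    have hc₁ := hP (i + 1) hi <;>
    rcases Nat.mod_two_eq_zero_or_one i with h | h
  · exact ⟨_, hm₀, _, hm₁, h₀, h₁, by simpa [h] using hc₀, by simpa [Nat.add_mod, h] using hc₁⟩
  · exact ⟨_, hm₁, _, hm₀, h₁, h₀, by simpa [Nat.add_mod, h] using hc₁, by simpa [h] using hc₀⟩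
  · exact ⟨_, hm₁, _, hm₀, h₁, h₀, by simpa [Nat.add_mod, h] using hc₁, by simpa [h] using hc₀⟩
  · exact ⟨_, hm₀, _, hm₁, h₀, h₁, by simpa [h] using hc₀, by simpa [Nat.add_mod, h] using hc₁⟩

/-- Flipping a path does not affect the edges of any color other than the two flipped ones. -/
theorem flipPath_eq_some_iff {V : Type*} [DecidableEq V] {G : SimpleGraph V} {κ : ℕ}
    {χ : Sym2 V → Option (Fin κ)} {α β c : Fin κ} {u v : V} {P : G.Walk u v}
    (hα : c ≠ α) (hβ : c ≠ β) (e : Sym2 V) :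
    flipPath G χ α β P e = some c ↔ χ e = some c := by
  unfold flipPath
  split_ifs <;> simp_all [eq_comm]

/-- **Flipping a maximal alternating path only changes the palettes of its endpoints**:
if `P` is a maximal `{α,β}`-alternating path from `u` to `v` of a partial `κ`-edge coloring
`χ` with `α ≠ β`, then for every vertex `z` distinct from `u` and `v` and every color `c`,
`c` is missing at `z` after flipping `P` iff it was missing at `z` before. -/
theorem flip_preserves_other_palettes {V : Type*} [Fintype V] [DecidableEq V]
    (G : SimpleGraph V) {κ : ℕ} (χ : Sym2 V → Option (Fin κ))
    (hχ : IsPartialEdgeColoring G χ) (α β : Fin κ) (hαβ : α ≠ β)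
    {u v : V} (P : G.Walk u v) (hP : P.IsPath)
    (hmax : IsMaximalAltPath G χ α β P)
    (z : V) (hzu : z ≠ u) (hzv : z ≠ v) (c : Fin κ) :
    MissingAt G (flipPath G χ α β P) z c ↔ MissingAt G χ z c := by
  by_cases hz : z ∈ P.support
  · obtain ⟨a, ha, b, hb, hza, hzb, hca, hcb⟩ := hmax.1.exists_edges_at hz hzu hzv
    have hGa := P.edges_subset_edgeSet ha
    have hGb := P.edges_subset_edgeSet hb
    have hfa : flipPath G χ α β P a = some β := by simp [flipPath, ha, hca]
    have hfb : flipPath G χ α β P b = some α := by simp [flipPath, hb, hcb, hαβ.symm]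
    by_cases hα : c = α
    · subst hα
      exact iff_of_false (fun h => h b hGb hzb hfb) (fun h => h a hGa hza hca)
    by_cases hβ : c = β
    · subst hβ
      exact iff_of_false (fun h => h a hGa hza hfa) (fun h => h b hGb hzb hcb)
    simp only [MissingAt, ne_eq, flipPath_eq_some_iff hα hβ]
  · refine forall₃_congr fun e _ hze => ?_
    have he : e ∉ P.edges := fun h => hz (SimpleGraph.Walk.mem_support_of_mem_edges h hze)
    simp [flipPath, he]
end

section
/- Let χ be a partial edge coloring of a finite simple undirected graph G with m edges and let c be a color. Then the total length (number of edges, counted over all colors c′ ≠ c) of all maximal {c,c′}-alternating paths in χ is at most 4m. -/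
/-- A maximal `{c,c'}`-alternating path (for some color `c' ≠ c`) of the partial
coloring `χ`, packaged with its data. -/
structure MaxAltPathWith {V : Type*} (G : SimpleGraph V) {κ : ℕ}
    (χ : Sym2 V → Option (Fin κ)) (c : Fin κ) where
  /-- first endpoint -/
  first : V
  /-- last endpoint -/
  last : V
  /-- the second color of the path's type -/
  c' : Fin κ
  c'_ne : c' ≠ c
  /-- the underlying walk -/
  walk : G.Walk first last
  isPath : walk.IsPath
  maximalAlt : IsMaximalAltPath G χ c c' walk

theorem IsPartialEdgeColoring.eq_of_mem {V : Type*} {G : SimpleGraph V} {κ : ℕ}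
    {χ : Sym2 V → Option (Fin κ)} (hχ : IsPartialEdgeColoring G χ) {e f : Sym2 V}
    (he : e ∈ G.edgeSet) (hf : f ∈ G.edgeSet) {v : V} (hve : v ∈ e) (hvf : v ∈ f)
    {a : Fin κ} (hea : χ e = some a) (hfa : χ f = some a) : e = f := by
  by_contra hne
  exact hχ e he f hf hne ⟨v, hve, hvf⟩ (by simp [hea]) (by simp [hfa]) (by rw [hea, hfa])

section AltPath

variable {V : Type*} {G : SimpleGraph V} {κ : ℕ} {χ : Sym2 V → Option (Fin κ)}
  {α β : Fin κ} {u v : V} {P : G.Walk u v}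

theorem IsAltPath.color (h : IsAltPath G χ α β P) {i : ℕ} (hi : i < P.edges.length) :
    χ P.edges[i] = some α ∨ χ P.edges[i] = some β := by
  rcases h with h | h <;> rw [h i hi] <;> split_ifs <;> simp

theorem IsAltPath.color_of_mem (h : IsAltPath G χ α β P) {e : Sym2 V} (he : e ∈ P.edges) :
    χ e = some α ∨ χ e = some β := by
  obtain ⟨i, hi, rfl⟩ := List.mem_iff_getElem.mp he
  exact h.color hi

/-- Two consecutive edges of an alternating path use both colors. -/
theorem IsAltPath.color_succ (h : IsAltPath G χ α β P) {i : ℕ} (hi : i + 1 < P.edges.length) :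
    (χ P.edges[i] = some α ∧ χ P.edges[i + 1] = some β) ∨
      (χ P.edges[i] = some β ∧ χ P.edges[i + 1] = some α) := by
  rcases h with h | h <;> rw [h i (by omega), h (i + 1) hi] <;>
    rcases Nat.mod_two_eq_zero_or_one i with hm | hm <;>
    simp [hm, Nat.add_mod]

theorem SimpleGraph.Walk.edges_getElem_eq (P : G.Walk u v) {i : ℕ} (hi : i < P.edges.length) :
    P.edges[i] = s(P.getVert i, P.getVert (i + 1)) := by
  induction P generalizing i with
  | nil => simp at hi
  | cons h p ih =>
    cases i with
    | zero => simp
    | succ i => simpa using ih (by simpa using hi)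

/-- The edge set of a maximal alternating path is closed under passing to adjacent edges
colored with one of the two colors. -/
theorem IsMaximalAltPath.mem_edges_of_adjacent (hχ : IsPartialEdgeColoring G χ)
    (h : IsMaximalAltPath G χ α β P) {e f : Sym2 V} (he : e ∈ P.edges) (hf : f ∈ G.edgeSet)
    (hfc : χ f = some α ∨ χ f = some β) {x : V} (hxe : x ∈ e) (hxf : x ∈ f) :
    f ∈ P.edges := by
  obtain ⟨halt, hu, hv⟩ := h
  have heG := P.edges_subset_edgeSet he
  have hec := halt.color_of_mem he
  have hend : (MissingAt G χ x α ∨ MissingAt G χ x β) → f ∈ P.edges := by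
    intro hx
    have hef : e = f := by
      rcases hx with hx | hx
      · exact hχ.eq_of_mem heG hf hxe hxf (hec.resolve_left (hx e heG hxe))
          (hfc.resolve_left (hx f hf hxf))
      · exact hχ.eq_of_mem heG hf hxe hxf (hec.resolve_right (hx e heG hxe))
          (hfc.resolve_right (hx f hf hxf))
    exact hef ▸ he
  obtain ⟨k, hk, rfl⟩ : ∃ k ≤ P.edges.length, x = P.getVert k := by
    obtain ⟨j, hj, rfl⟩ := List.mem_iff_getElem.mp he
    rw [P.edges_getElem_eq hj, Sym2.mem_iff] at hxe
    rcases hxe with rfl | rfl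
    exacts [⟨j, hj.le, rfl⟩, ⟨j + 1, hj, rfl⟩]
  cases k with
  | zero => exact hend (by simpa using hu)
  | succ k =>
    rcases hk.eq_or_lt with hk | hk
    · refine hend ?_
      rw [hk, SimpleGraph.Walk.length_edges, SimpleGraph.Walk.getVert_length]
      exact hv
    · have hk' : k < P.edges.length := by omega
      have hG : ∀ {i} (hi : i < P.edges.length), P.edges[i] ∈ G.edgeSet := fun hi =>
        P.edges_subset_edgeSet (List.getElem_mem hi)
      have h1 : P.getVert (k + 1) ∈ P.edges[k] := by
        rw [P.edges_getElem_eq hk']; simp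
      have h2 : P.getVert (k + 1) ∈ P.edges[k + 1] := by
        rw [P.edges_getElem_eq hk]; simp
      have key : f = P.edges[k] ∨ f = P.edges[k + 1] := by
        rcases halt.color_succ hk with ⟨ha, hb⟩ | ⟨hb, ha⟩ <;> rcases hfc with hc | hc
        · exact .inl (hχ.eq_of_mem hf (hG hk') hxf h1 hc ha)
        · exact .inr (hχ.eq_of_mem hf (hG hk) hxf h2 hc hb)
        · exact .inr (hχ.eq_of_mem hf (hG hk) hxf h2 hc ha)
        · exact .inl (hχ.eq_of_mem hf (hG hk') hxf h1 hc hb)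
      rcases key with rfl | rfl <;> exact List.getElem_mem _

/-- A maximal alternating path contains every alternating path with which it shares an edge. -/
theorem IsMaximalAltPath.edges_subset (hχ : IsPartialEdgeColoring G χ)
    (h : IsMaximalAltPath G χ α β P) {u' v' : V} {Q : G.Walk u' v'} (hQ : IsAltPath G χ α β Q)
    {e : Sym2 V} (heP : e ∈ P.edges) (heQ : e ∈ Q.edges) : Q.edges ⊆ P.edges := by
  have step : ∀ i (hi : i + 1 < Q.edges.length),
      Q.edges[i] ∈ P.edges ↔ Q.edges[i + 1] ∈ P.edges := by
    intro i hi
    have hi' : i < Q.edges.length := by omega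
    have hG : ∀ {j} (hj : j < Q.edges.length), Q.edges[j] ∈ G.edgeSet := fun hj =>
      Q.edges_subset_edgeSet (List.getElem_mem hj)
    have h1 : Q.getVert (i + 1) ∈ Q.edges[i] := by
      rw [Q.edges_getElem_eq hi']; simp
    have h2 : Q.getVert (i + 1) ∈ Q.edges[i + 1] := by
      rw [Q.edges_getElem_eq hi]; simp
    exact ⟨fun hm => h.mem_edges_of_adjacent hχ hm (hG hi) (hQ.color hi) h1 h2,
      fun hm => h.mem_edges_of_adjacent hχ hm (hG hi') (hQ.color hi') h2 h1⟩
  have all : ∀ i (hi : i < Q.edges.length),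
      Q.edges[i] ∈ P.edges ↔ Q.edges[0]'(by omega) ∈ P.edges := by
    intro i
    induction i with
    | zero => intro _; rfl
    | succ i ih => intro hi; rw [← step i hi]; exact ih (by omega)
  obtain ⟨j, hj, rfl⟩ := List.mem_iff_getElem.mp heQ
  intro f hf
  obtain ⟨i, hi, rfl⟩ := List.mem_iff_getElem.mp hf
  exact (all i hi).2 ((all j hj).1 heP)

/-- At least `⌊|P| / 2⌋` edges of an alternating path avoid its first color. -/
theorem IsAltPath.half_length_le_card [DecidableEq V] (h : IsAltPath G χ α β P)
    (hP : P.IsPath) (hβ : β ≠ α) :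
    P.length / 2 ≤ (P.edges.toFinset.filter fun e => χ e ≠ some α).card := by
  have hnodup := hP.isTrail.edges_nodup
  have hlen := P.length_edges
  obtain ⟨r, hr, hcol⟩ : ∃ r < 2, ∀ k (hk : 2 * k + r < P.edges.length),
      χ P.edges[2 * k + r] = some β := by
    rcases h with h | h
    · exact ⟨1, by omega, fun k hk => by rw [h _ hk, if_neg (by omega)]⟩
    · exact ⟨0, by omega, fun k hk => by rw [h _ hk, if_pos (by omega)]⟩
  have hidx : ∀ k : Fin (P.length / 2), 2 * (k : ℕ) + r < P.edges.length := fun k => by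
    have := k.2
    omega
  have := Finset.card_le_card_of_injOn (s := (Finset.univ : Finset (Fin (P.length / 2))))
    (t := P.edges.toFinset.filter fun e => χ e ≠ some α)
    (fun k => P.edges[2 * (k : ℕ) + r]'(hidx k))
    (fun k _ => by simp [hcol k (hidx k), hβ])
    (fun k _ l _ hkl => by
      have := (hnodup.getElem_inj_iff).1 hkl
      ext
      omega)
  simpa using this

end AltPath

namespace MaxAltPathWith

variable {V : Type*} [DecidableEq V] {G : SimpleGraph V} {κ : ℕ} {χ : Sym2 V → Option (Fin κ)}
  {c : Fin κ}

/-- Edges charged for the length of a maximal alternating path: the edge itself if the path has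
length one, and the edges not colored `c` otherwise. -/
def charged (p : MaxAltPathWith G χ c) : Finset (Sym2 V) :=
  p.walk.edges.toFinset.filter fun e => p.walk.length = 1 ∨ χ e ≠ some c

theorem length_le_three_mul_card_charged (p : MaxAltPathWith G χ c) :
    p.walk.length ≤ 3 * p.charged.card := by
  by_cases h1 : p.walk.length = 1
  · have : p.charged.card = p.walk.length := by
      simp [charged, h1, List.toFinset_card_of_nodup p.isPath.isTrail.edges_nodup]
    omega
  · have := p.maximalAlt.1.half_length_le_card p.isPath p.c'_ne
    simp only [charged, h1, false_or]
    omega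

theorem mem_edges_iff_of_mem_charged (hχ : IsPartialEdgeColoring G χ)
    {p q : MaxAltPathWith G χ c} {e : Sym2 V} (hp : e ∈ p.charged) (hq : e ∈ q.charged)
    (f : Sym2 V) : f ∈ p.walk.edges ↔ f ∈ q.walk.edges := by
  simp only [charged, Finset.mem_filter, List.mem_toFinset] at hp hq
  obtain ⟨hep, hp⟩ := hp
  obtain ⟨heq, hq⟩ := hq
  by_cases hc : χ e = some c
  · have single : ∀ r : MaxAltPathWith G χ c, e ∈ r.walk.edges → r.walk.length = 1 →
        r.walk.edges = [e] := by
      intro r her hr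
      rw [← r.walk.length_edges] at hr
      obtain ⟨a, ha⟩ := List.length_eq_one_iff.mp hr
      rw [ha, List.mem_singleton] at her
      rw [ha, her]
    rw [single p hep (by tauto), single q heq (by tauto)]
  · have hpc := (p.maximalAlt.1.color_of_mem hep).resolve_left hc
    have hqc := (q.maximalAlt.1.color_of_mem heq).resolve_left hc
    have hcc : p.c' = q.c' := Option.some.inj (hpc.symm.trans hqc)
    have hpm := p.maximalAlt
    rw [hcc] at hpm
    exact ⟨fun hf => q.maximalAlt.edges_subset hχ hpm.1 heq hep hf,
      fun hf => hpm.edges_subset hχ q.maximalAlt.1 hep heq hf⟩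

end MaxAltPathWith


/-- **Total length of all maximal `{c,·}`-alternating paths is at most `4m`**: for a partial
edge coloring `χ` of a finite simple graph with `m` edges and a color `c`, any family of
pairwise distinct (i.e. with pairwise different edge sets) maximal `{c,c'}`-alternating
paths, over all colors `c' ≠ c`, has total length at most `4m`. -/
theorem total_length_maximal_alt_paths {V : Type*} [Fintype V] (G : SimpleGraph V) {κ : ℕ}
    (χ : Sym2 V → Option (Fin κ)) (hχ : IsPartialEdgeColoring G χ)
    (c : Fin κ) (m : ℕ) (hm : G.edgeSet.ncard = m)
    (n : ℕ) (F : Fin n → MaxAltPathWith G χ c)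
    (hdistinct : ∀ i j : Fin n, i ≠ j →
      ¬ (∀ e : Sym2 V, e ∈ (F i).walk.edges ↔ e ∈ (F j).walk.edges)) :
    (∑ i : Fin n, (F i).walk.length) ≤ 4 * m := by
  classical
  have hdisj : ∀ i ∈ Finset.univ, ∀ j ∈ Finset.univ, i ≠ j →
      Disjoint (F i).charged (F j).charged := by
    intro i _ j _ hij
    rw [Finset.disjoint_left]
    exact fun e hi hj => hdistinct i j hij
      (MaxAltPathWith.mem_edges_iff_of_mem_charged hχ hi hj)
  have hcard : ∑ i, (F i).charged.card ≤ m := by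
    rw [← Finset.card_biUnion hdisj, ← hm, ← Set.ncard_coe_finset]
    refine Set.ncard_le_ncard (fun e he => ?_) (Set.toFinite _)
    simp only [Finset.coe_biUnion, Set.mem_iUnion, MaxAltPathWith.charged] at he
    obtain ⟨i, _, he⟩ := he
    exact (F i).walk.edges_subset_edgeSet
      (List.mem_toFinset.mp (Finset.mem_filter.mp he).1)
  calc ∑ i, (F i).walk.length ≤ ∑ i, 3 * (F i).charged.card :=
        Finset.sum_le_sum fun i _ => (F i).length_le_three_mul_card_charged
    _ = 3 * ∑ i, (F i).charged.card := by rw [Finset.mul_sum]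
    _ ≤ 4 * m := by omega
end

section
/- Let χ be a partial edge coloring of a finite simple undirected graph G and let f = (u,v,w,α,β) be a u-fan: u, v, w are distinct vertices, α ≠ β are colors, (u,v) and (u,w) are uncolored edges, α ∈ miss_χ(u), and β ∈ miss_χ(v) ∩ miss_χ(w). Then there exists x ∈ {v,w} such that the maximal {α,β}-alternating path starting at x does not have u as its other endpoint; consequently, after flipping that path, α is missing at both u and x, so there exists a partial edge coloring χ′ whose colored edges are exactly those of χ together with the edge (u,x). -/
open SimpleGraph in
/-- In a graph of maximum degree at most two, two paths with a common start that both avoid a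
neighbor of that start cannot end at two distinct vertices of degree at most one. -/
theorem end_eq_of_isPath {V : Type*} {H : SimpleGraph V}
    (hdeg : ∀ a x y y' : V, H.Adj a x → H.Adj a y → H.Adj a y' → y ≠ x → y' ≠ x → y = y')
    {b c : V} (hb : ∀ y y', H.Adj b y → H.Adj b y' → y = y')
    (hc : ∀ y y', H.Adj c y → H.Adj c y' → y = y')
    {a : V} (p : H.Walk a b) :
    ∀ (z : V) (q : H.Walk a c), p.IsPath → q.IsPath → H.Adj a z →
      z ∉ p.support → z ∉ q.support → b = c := by
  induction p with
  | nil =>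
    intro z q _ _ hz _ hzq
    cases q with
    | nil => rfl
    | cons h q' =>
      exact absurd (by simp [hb _ _ hz h]) hzq
  | cons h p' ih =>
    intro z q hp hq hz hzp hzq
    cases q with
    | nil => exact absurd (by simp [hc _ _ hz h]) hzp
    | cons h' q' =>
      rw [Walk.cons_isPath_iff] at hp hq
      rw [Walk.support_cons, List.mem_cons, not_or] at hzp hzq
      have hy := hdeg _ _ _ _ hz h h' (fun e => hzp.2 (e ▸ p'.start_mem_support))
        (fun e => hzq.2 (e ▸ q'.start_mem_support))
      subst hy
      exact ih hb _ q' hp.1 hq.1 h.symm hp.2 hq.2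

open SimpleGraph in
/-- In a graph of maximum degree at most two, a connected component contains at most two vertices
of degree at most one. -/
theorem eq_of_reachable_of_degree_le_one {V : Type*} {H : SimpleGraph V}
    (hdeg : ∀ a x y y' : V, H.Adj a x → H.Adj a y → H.Adj a y' → y ≠ x → y' ≠ x → y = y')
    {a b c : V} (ha : ∀ y y', H.Adj a y → H.Adj a y' → y = y')
    (hb : ∀ y y', H.Adj b y → H.Adj b y' → y = y')
    (hc : ∀ y y', H.Adj c y → H.Adj c y' → y = y')
    (hab : a ≠ b) (hac : a ≠ c) (hrb : H.Reachable a b) (hrc : H.Reachable a c) : b = c := by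
  obtain ⟨p, hp⟩ := hrb.exists_isPath
  obtain ⟨q, hq⟩ := hrc.exists_isPath
  cases p with
  | nil => exact absurd rfl hab
  | cons h p' =>
    cases q with
    | nil => exact absurd rfl hac
    | cons h' q' =>
      have hy := ha _ _ h h'
      subst hy
      rw [Walk.cons_isPath_iff] at hp hq
      exact end_eq_of_isPath hdeg hb hc p' a q' hp.1 hq.1 h.symm hp.2 hq.2

/-- The subgraph of `G` formed by the edges colored `α` or `β`. -/
def altGraph {V : Type*} (G : SimpleGraph V) {κ : ℕ} (χ : Sym2 V → Option (Fin κ))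
    (α β : Fin κ) : SimpleGraph V where
  Adj a b := G.Adj a b ∧ (χ s(a, b) = some α ∨ χ s(a, b) = some β)
  symm := ⟨fun a b h => ⟨h.1.symm, by rw [Sym2.eq_swap]; exact h.2⟩⟩
  loopless := ⟨fun a h => G.loopless.irrefl a h.1⟩

section

variable {V : Type*} {G : SimpleGraph V} {κ : ℕ} {χ : Sym2 V → Option (Fin κ)} {α β : Fin κ}

theorem IsPartialEdgeColoring.eq_of_adj (hχ : IsPartialEdgeColoring G χ) {a y y' : V}
    {c : Fin κ} (h : G.Adj a y) (h' : G.Adj a y') (hc : χ s(a, y) = some c)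
    (hc' : χ s(a, y') = some c) : y = y' := by
  by_contra hne
  exact hχ s(a, y) h s(a, y') h' (fun e => hne (Sym2.congr_right.1 e)) ⟨a, by simp, by simp⟩
    (by simp [hc]) (by simp [hc']) (hc.trans hc'.symm)

theorem altGraph_eq_of_adj (hχ : IsPartialEdgeColoring G χ) (a x y y' : V)
    (hx : (altGraph G χ α β).Adj a x) (hy : (altGraph G χ α β).Adj a y)
    (hy' : (altGraph G χ α β).Adj a y') (hyx : y ≠ x) (hyx' : y' ≠ x) : y = y' := by
  obtain ⟨gx, hx⟩ := hx
  obtain ⟨gy, hy⟩ := hy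
  obtain ⟨gy', hy'⟩ := hy'
  rcases hx with hx | hx <;> rcases hy with hy | hy <;> rcases hy' with hy' | hy' <;>
    first
    | exact hχ.eq_of_adj gy gy' hy hy'
    | exact absurd (hχ.eq_of_adj gy gx hy hx) hyx
    | exact absurd (hχ.eq_of_adj gy' gx hy' hx) hyx'

theorem altGraph_eq_of_adj_of_missingAt (hχ : IsPartialEdgeColoring G χ) {a : V}
    (ha : MissingAt G χ a α ∨ MissingAt G χ a β) (y y' : V)
    (hy : (altGraph G χ α β).Adj a y) (hy' : (altGraph G χ α β).Adj a y') : y = y' := by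
  obtain ⟨gy, hy⟩ := hy
  obtain ⟨gy', hy'⟩ := hy'
  rcases hy with hy | hy <;> rcases hy' with hy' | hy' <;>
    first
    | exact hχ.eq_of_adj gy gy' hy hy'
    | rcases ha with ha | ha <;>
        first
        | exact absurd hy (ha _ gy (by simp))
        | exact absurd hy' (ha _ gy' (by simp))

theorem IsAltPath.reachable_altGraph {a b : V} {P : G.Walk a b} (hP : IsAltPath G χ α β P) :
    (altGraph G χ α β).Reachable a b := by
  have hcol : ∀ e ∈ P.edges, χ e = some α ∨ χ e = some β := by
    intro e he
    obtain ⟨i, hi, rfl⟩ := List.getElem_of_mem he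
    rcases hP with hP | hP <;> rw [hP i hi] <;> split_ifs <;> simp
  refine ⟨P.transfer _ fun e he => ?_⟩
  have hG := P.edges_subset_edgeSet he
  have hc := hcol e he
  induction e using Sym2.ind with
  | _ s t => exact ⟨hG, hc⟩

open Classical in
/-- The coloring obtained by exchanging `α` and `β` on the edges that meet `C`. -/
noncomputable def flipOn (χ : Sym2 V → Option (Fin κ)) (α β : Fin κ) (C : Set V)
    (e : Sym2 V) : Option (Fin κ) :=
  if ∃ y ∈ e, y ∈ C then (χ e).map (Equiv.swap α β) else χ e

theorem flipOn_eq_none_iff (C : Set V) (e : Sym2 V) :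
    flipOn χ α β C e = none ↔ χ e = none := by
  unfold flipOn
  split_ifs <;> simp

theorem flipOn_of_mem {C : Set V} {e : Sym2 V} {t : V} (ht : t ∈ e) (htC : t ∈ C) :
    flipOn χ α β C e = (χ e).map (Equiv.swap α β) :=
  if_pos ⟨t, ht, htC⟩

theorem flipOn_of_notMem {C : Set V}
    (hC : ∀ s t, (altGraph G χ α β).Adj s t → s ∈ C → t ∈ C) {e : Sym2 V}
    (he : e ∈ G.edgeSet) {t : V} (ht : t ∈ e) (htC : t ∉ C) : flipOn χ α β C e = χ e := by
  unfold flipOn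
  split_ifs with h
  · obtain ⟨s, hs, hsC⟩ := h
    have hst : s ≠ t := fun h => htC (h ▸ hsC)
    obtain rfl := (Sym2.mem_and_mem_iff hst).1 ⟨hs, ht⟩
    cases hc : χ s(s, t) with
    | none => rfl
    | some c =>
      have hα : c ≠ α := fun h => htC (hC s t ⟨he, .inl (h ▸ hc)⟩ hsC)
      have hβ : c ≠ β := fun h => htC (hC s t ⟨he, .inr (h ▸ hc)⟩ hsC)
      simp [Equiv.swap_apply_of_ne_of_ne hα hβ]
  · rfl

theorem IsPartialEdgeColoring.flipOn (hχ : IsPartialEdgeColoring G χ) {C : Set V}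
    (hC : ∀ s t, (altGraph G χ α β).Adj s t → s ∈ C → t ∈ C) :
    IsPartialEdgeColoring G (flipOn χ α β C) := by
  rintro e he f hf hef ⟨t, hte, htf⟩ hne hnf
  have hne' := (flipOn_eq_none_iff C e).not.1 hne
  have hnf' := (flipOn_eq_none_iff C f).not.1 hnf
  have key := hχ e he f hf hef ⟨t, hte, htf⟩ hne' hnf'
  by_cases htC : t ∈ C
  · rw [flipOn_of_mem hte htC, flipOn_of_mem htf htC]
    exact fun h => key (Option.map_injective (Equiv.injective _) h)
  · rwa [flipOn_of_notMem hC he hte htC, flipOn_of_notMem hC hf htf htC]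

open Classical in
/-- An edge both of whose endpoints miss `c` can be colored `c`. -/
theorem IsPartialEdgeColoring.update (hχ : IsPartialEdgeColoring G χ) {u x : V} {c : Fin κ}
    (hu : MissingAt G χ u c) (hx : MissingAt G χ x c) :
    IsPartialEdgeColoring G (Function.update χ s(u, x) (some c)) := by
  have key : ∀ e ∈ G.edgeSet, (∃ t, t ∈ s(u, x) ∧ t ∈ e) → χ e ≠ some c := by
    rintro e he ⟨t, ht, hte⟩
    rcases Sym2.mem_iff.1 ht with rfl | rfl
    · exact hu e he hte
    · exact hx e he hte
  rintro e he f hf hef ⟨t, hte, htf⟩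
  by_cases h : e = s(u, x)
  · subst h
    rw [Function.update_self, Function.update_of_ne hef.symm]
    exact fun _ _ h => key f hf ⟨t, hte, htf⟩ h.symm
  by_cases h' : f = s(u, x)
  · subst h'
    rw [Function.update_self, Function.update_of_ne hef]
    exact fun _ _ => key e he ⟨t, htf, hte⟩
  · rw [Function.update_of_ne h, Function.update_of_ne h']
    exact hχ e he f hf hef ⟨t, hte, htf⟩

open Classical in
/-- If `u` misses `α`, `x` misses `β`, and no `{α,β}`-alternating path joins `x` to `u`, then the
coloring extends, after a flip, to the edge `(u,x)`. -/
theorem IsPartialEdgeColoring.exists_extend_of_not_reachable (hχ : IsPartialEdgeColoring G χ)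
    {u x : V} (hux : G.Adj u x) (hu : MissingAt G χ u α) (hx : MissingAt G χ x β)
    (hr : ¬ (altGraph G χ α β).Reachable x u) :
    ∃ χ' : Sym2 V → Option (Fin κ), IsPartialEdgeColoring G χ' ∧
      {e : Sym2 V | e ∈ G.edgeSet ∧ χ' e ≠ none} =
        insert s(u, x) {e : Sym2 V | e ∈ G.edgeSet ∧ χ e ≠ none} := by
  set C : Set V := {y | (altGraph G χ α β).Reachable x y}
  have hC : ∀ s t, (altGraph G χ α β).Adj s t → s ∈ C → t ∈ C :=
    fun s t hst hs => SimpleGraph.Reachable.trans hs hst.reachable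
  have hxC : x ∈ C := SimpleGraph.Reachable.refl x
  have hu' : MissingAt G (_root_.flipOn χ α β C) u α := fun e he hue => by
    rw [flipOn_of_notMem hC he hue hr]
    exact hu e he hue
  have hx' : MissingAt G (_root_.flipOn χ α β C) x α := fun e he hxe h => by
    rw [flipOn_of_mem hxe hxC, Option.map_eq_some_iff] at h
    obtain ⟨c, hc, hcα⟩ := h
    rw [Equiv.swap_apply_eq_iff, Equiv.swap_apply_left] at hcα
    exact hx e he hxe (hcα ▸ hc)
  refine ⟨_, (hχ.flipOn hC).update hu' hx', ?_⟩
  ext e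
  by_cases h : e = s(u, x)
  · subst h
    simpa using hux
  · simp [h, flipOn_eq_none_iff]

end

/-- **U-fan activation**: let `χ` be a partial edge coloring of a finite simple graph `G` and
`(u,v,w,α,β)` a u-fan: `u`, `v`, `w` are distinct vertices, `α ≠ β`, `(u,v)` and `(u,w)` are
uncolored edges, `α ∈ miss_χ(u)`, and `β ∈ miss_χ(v) ∩ miss_χ(w)`. Then there is
`x ∈ {v,w}` such that the maximal `{α,β}`-alternating path starting at `x` does not have `u`
as its other endpoint, and (flipping that path) there exists a partial edge coloring `χ'`
whose colored edges are exactly those of `χ` together with the edge `(u,x)`. -/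
theorem ufan_activation {V : Type*} [Fintype V] (G : SimpleGraph V) {κ : ℕ}
    (χ : Sym2 V → Option (Fin κ)) (hχ : IsPartialEdgeColoring G χ)
    (u v w : V) (huv : G.Adj u v) (huw : G.Adj u w)
    (hvw : v ≠ w) (α β : Fin κ) (hαβ : α ≠ β)
    (huncv : χ s(u, v) = none) (huncw : χ s(u, w) = none)
    (hu : MissingAt G χ u α) (hv : MissingAt G χ v β) (hw : MissingAt G χ w β) :
    ∃ x : V, (x = v ∨ x = w) ∧
      (∀ P : G.Walk x u, P.IsPath → IsMaximalAltPath G χ α β P → False) ∧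
      ∃ χ' : Sym2 V → Option (Fin κ), IsPartialEdgeColoring G χ' ∧
        {e : Sym2 V | e ∈ G.edgeSet ∧ χ' e ≠ none} =
          insert s(u, x) {e : Sym2 V | e ∈ G.edgeSet ∧ χ e ≠ none} := by
  have hnot : ¬ (altGraph G χ α β).Reachable v u ∨ ¬ (altGraph G χ α β).Reachable w u := by
    by_contra! h
    exact hvw (eq_of_reachable_of_degree_le_one (altGraph_eq_of_adj hχ)
      (altGraph_eq_of_adj_of_missingAt hχ (.inl hu))
      (altGraph_eq_of_adj_of_missingAt hχ (.inr hv))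
      (altGraph_eq_of_adj_of_missingAt hχ (.inr hw)) huv.ne huw.ne h.1.symm h.2.symm)
  rcases hnot with h | h
  · exact ⟨v, .inl rfl, fun P _ hP => h hP.1.reachable_altGraph,
      hχ.exists_extend_of_not_reachable huv hu hv h⟩
  · exact ⟨w, .inr rfl, fun P _ hP => h hP.1.reachable_altGraph,
      hχ.exists_extend_of_not_reachable huw hu hw h⟩
end

section
/- Let G be a finite loopless multigraph with maximum degree Δ and let χ be a partial ⌊3Δ/2⌋-edge coloring of G. Let (u,v) be an uncolored edge, and let (u,w) be an edge with w ≠ v whose color γ = χ(u,w) satisfies γ ∈ miss_χ(v). If miss_χ(u) is disjoint from both miss_χ(v) and miss_χ(w), then miss_χ(v) ∩ miss_χ(w) ≠ ∅. -/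
/-- The color `c` is missing at the vertex `x`: no edge incident on `x` has color `c`. -/
def MissingAtM {V E : Type*} (ends : E → Sym2 V) {κ : ℕ}
    (χ : E → Option (Fin κ)) (x : V) (c : Fin κ) : Prop :=
  ∀ e : E, x ∈ ends e → χ e ≠ some c

open Classical in
/-- Every color is either missing at `x` or used by a colored edge incident on `x`. -/
theorem card_le_card_missingAtM_add_card_colored {V E : Type*} [Fintype E]
    (ends : E → Sym2 V) {κ : ℕ} (χ : E → Option (Fin κ)) (x : V) :
    κ ≤ (Finset.univ.filter (MissingAtM ends χ x)).card +
      (Finset.univ.filter fun e => x ∈ ends e ∧ χ e ≠ none).card := by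
  have hsub : (Finset.univ.filter fun c => ¬ MissingAtM ends χ x c).map .some ⊆
      (Finset.univ.filter fun e => x ∈ ends e ∧ χ e ≠ none).image χ := by
    intro o ho
    simp only [Finset.mem_map, Finset.mem_filter, Finset.mem_univ, true_and, MissingAtM,
      not_forall, not_not] at ho
    obtain ⟨c, ⟨e, he, hc⟩, rfl⟩ := ho
    exact Finset.mem_image.mpr ⟨e, by simp [he, hc], hc⟩
  have hused := (Finset.card_le_card hsub).trans Finset.card_image_le
  rw [Finset.card_map] at hused
  have htotal := Finset.card_filter_add_card_filter_not (s := Finset.univ) (MissingAtM ends χ x)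
  rw [Finset.card_univ, Fintype.card_fin] at htotal
  omega

open Classical in
theorem le_card_missingAtM_add {V E : Type*} [Fintype E] (ends : E → Sym2 V) {κ Δ : ℕ}
    (χ : E → Option (Fin κ)) {x : V} (hΔ : Nat.card {e : E // x ∈ ends e} ≤ Δ) :
    κ ≤ (Finset.univ.filter (MissingAtM ends χ x)).card + Δ := by
  have hcount := card_le_card_missingAtM_add_card_colored ends χ x
  have hle : (Finset.univ.filter fun e => x ∈ ends e ∧ χ e ≠ none).card ≤
      (Finset.univ.filter fun e => x ∈ ends e).card :=
    Finset.card_le_card (Finset.monotone_filter_right _ fun _ _ h => h.1)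
  rw [Nat.card_eq_fintype_card, Fintype.card_subtype] at hΔ
  omega

open Classical in
/-- An uncolored edge at `x` leaves one more color missing there. -/
theorem succ_le_card_missingAtM_add {V E : Type*} [Fintype E] (ends : E → Sym2 V) {κ Δ : ℕ}
    (χ : E → Option (Fin κ)) {x : V} (hΔ : Nat.card {e : E // x ∈ ends e} ≤ Δ)
    {e₀ : E} (hx : x ∈ ends e₀) (hunc : χ e₀ = none) :
    κ + 1 ≤ (Finset.univ.filter (MissingAtM ends χ x)).card + Δ := by
  have hcount := card_le_card_missingAtM_add_card_colored ends χ x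
  have hlt : (Finset.univ.filter fun e => x ∈ ends e ∧ χ e ≠ none).card <
      (Finset.univ.filter fun e => x ∈ ends e).card := by
    refine Finset.card_lt_card (Finset.ssubset_iff_of_subset
      (Finset.monotone_filter_right _ fun _ _ h => h.1) |>.mpr ⟨e₀, ?_, ?_⟩)
    · simpa using hx
    · simp [hunc]
  rw [Nat.card_eq_fintype_card, Fintype.card_subtype] at hΔ
  omega

/-- **Palette intersection for Shannon fans** (Lemma B.3): let `G` be a finite loopless
multigraph with maximum degree `Δ`, `χ` a partial `⌊3Δ/2⌋`-edge coloring, `(u,v)` an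
uncolored edge, and `(u,w)` an edge with `w ≠ v` whose color `γ` satisfies `γ ∈ miss_χ(v)`.
If `miss_χ(u)` is disjoint from both `miss_χ(v)` and `miss_χ(w)`, then
`miss_χ(v) ∩ miss_χ(w) ≠ ∅`. -/
theorem shannon_fan_palette_intersection {V E : Type*} [Fintype V] [Fintype E]
    (ends : E → Sym2 V) (hloopless : ∀ e : E, ¬ (ends e).IsDiag)
    (Δ : ℕ) (hΔ : ∀ x : V, Nat.card {e : E // x ∈ ends e} ≤ Δ)
    (χ : E → Option (Fin (3 * Δ / 2))) (hχ : IsPartialEdgeColoringM ends χ)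
    (u v w : V)
    (e₀ : E) (hends₀ : ends e₀ = s(u, v)) (hunc : χ e₀ = none)
    (e₁ : E) (hends₁ : ends e₁ = s(u, w)) (hwv : w ≠ v)
    (γ : Fin (3 * Δ / 2)) (hγ : χ e₁ = some γ) (hγv : MissingAtM ends χ v γ)
    (hdisj_uv : ∀ c, ¬ (MissingAtM ends χ u c ∧ MissingAtM ends χ v c))
    (hdisj_uw : ∀ c, ¬ (MissingAtM ends χ u c ∧ MissingAtM ends χ w c)) :
    ∃ c, MissingAtM ends χ v c ∧ MissingAtM ends χ w c := by
  classical
  by_contra! hvw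
  have hu := succ_le_card_missingAtM_add ends χ (hΔ u) (by simp [hends₀]) hunc
  have hv := succ_le_card_missingAtM_add ends χ (hΔ v) (by simp [hends₀]) hunc
  have hw := le_card_missingAtM_add ends χ (hΔ w)
  have huv : Disjoint (Finset.univ.filter (MissingAtM ends χ u))
      (Finset.univ.filter (MissingAtM ends χ v)) :=
    Finset.disjoint_filter.mpr fun c _ h₁ h₂ => hdisj_uv c ⟨h₁, h₂⟩
  have huvw : Disjoint (Finset.univ.filter (MissingAtM ends χ u) ∪
      Finset.univ.filter (MissingAtM ends χ v)) (Finset.univ.filter (MissingAtM ends χ w)) :=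
    Finset.disjoint_union_left.mpr
      ⟨Finset.disjoint_filter.mpr fun c _ h₁ h₂ => hdisj_uw c ⟨h₁, h₂⟩,
        Finset.disjoint_filter.mpr fun c _ h₁ h₂ => hvw c h₁ h₂⟩
  have htotal := Finset.card_le_univ (Finset.univ.filter (MissingAtM ends χ u) ∪
    Finset.univ.filter (MissingAtM ends χ v) ∪ Finset.univ.filter (MissingAtM ends χ w))
  rw [Finset.card_union_of_disjoint huvw, Finset.card_union_of_disjoint huv,
    Fintype.card_fin] at htotal
  omega
end

section
/- Let G be a finite simple undirected graph with maximum degree Δ, let χ be a partial (Δ+1)-edge coloring of G, let (u,v) be an uncolored edge, let α ∈ miss_χ(u), and let clr be any function assigning to each vertex x a color clr(x) ∈ miss_χ(x). Then there exists a Vizing fan F = (u,α),(v₁,c₁),…,(v_k,c_k) with v₁ = v and cᵢ = clr(vᵢ) for all i; that is: v₁,…,v_k are distinct neighbours of u with cᵢ ∈ miss_χ(vᵢ) for all i, χ(u,v₁) = ⊥ and χ(u,vᵢ) = c_{i−1} for all i > 1, and either c_k ∈ miss_χ(u) or c_k ∈ {c₁,…,c_{k−1}}. -/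
/-- `l` is a (not necessarily complete) Vizing fan at `u` starting with `v`, where each vertex `x`
of the fan carries the color `clr x`. -/
structure IsFanPrefix {V : Type*} (G : SimpleGraph V) {κ : ℕ} (χ : Sym2 V → Option (Fin κ))
    (clr : V → Fin κ) (u v : V) (l : List V) (hne : l ≠ []) : Prop where
  nodup : l.Nodup
  head_eq : l.head hne = v
  adj : ∀ x ∈ l, G.Adj u x
  color_succ : ∀ (i : ℕ) (h : i + 1 < l.length),
    χ s(u, l[i + 1]'h) = some (clr (l[i]'(Nat.lt_of_succ_lt h)))

theorem exists_adj_of_not_missingAt {V : Type*} {G : SimpleGraph V} {κ : ℕ}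
    {χ : Sym2 V → Option (Fin κ)} {u : V} {c : Fin κ} (h : ¬ MissingAt G χ u c) :
    ∃ w, G.Adj u w ∧ χ s(u, w) = some c := by
  unfold MissingAt at h
  push Not at h
  obtain ⟨e, he, hu, hc⟩ := h
  obtain ⟨w, rfl⟩ := Sym2.mem_iff_exists.mp hu
  exact ⟨w, he, hc⟩

/-- A fan prefix whose last color is neither missing at `u` nor repeated can be extended. -/
theorem IsFanPrefix.exists_concat {V : Type*} {G : SimpleGraph V} {κ : ℕ}
    {χ : Sym2 V → Option (Fin κ)} {clr : V → Fin κ} {u v : V} {l : List V} {hne : l ≠ []}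
    (hl : IsFanPrefix G χ clr u v l hne) (hunc : χ s(u, v) = none)
    (hmiss : ¬ MissingAt G χ u (clr (l.getLast hne)))
    (hrep : ∀ x ∈ l.dropLast, clr x ≠ clr (l.getLast hne)) :
    ∃ w, IsFanPrefix G χ clr u v (l ++ [w]) (by simp) := by
  obtain ⟨w, hadj, hw⟩ := exists_adj_of_not_missingAt hmiss
  have hwl : w ∉ l := by
    intro hmem
    obtain ⟨j, hj, rfl⟩ := List.getElem_of_mem hmem
    cases j with
    | zero =>
      rw [← List.head_eq_getElem hne, hl.head_eq, hunc] at hw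
      cases hw
    | succ i =>
      rw [hl.color_succ i hj] at hw
      refine hrep (l[i]) ?_ (Option.some.inj hw)
      rw [List.mem_iff_getElem]
      exact ⟨i, by simp; omega, by simp⟩
  refine ⟨w, ?_, ?_, ?_, ?_⟩
  · simpa using hl.nodup.concat hwl
  · rw [List.head_append_of_ne_nil hne, hl.head_eq]
  · intro x hx
    rcases List.mem_append.mp hx with hx | hx
    · exact hl.adj x hx
    · rwa [List.mem_singleton.mp hx]
  · intro i h
    rw [List.length_append, List.length_singleton] at h
    rw [List.getElem_append_left (show i < l.length by omega)]
    by_cases hi : i + 1 < l.length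
    · rw [List.getElem_append_left hi]
      exact hl.color_succ i hi
    · have hlast : l.getLast hne = l[i] := by
        rw [List.getLast_eq_getElem]
        congr 1
        omega
      rw [List.getElem_append_right (by omega), List.getElem_singleton, hw, hlast]

/-- **Existence of Vizing fans** (Definition 4.1 / Algorithm 2): let `G` be a finite simple
graph with maximum degree `Δ`, `χ` a partial `(Δ+1)`-edge coloring, `(u,v)` an uncolored
edge, `α ∈ miss_χ(u)`, and `clr` a function assigning to each vertex `x` a color
`clr x ∈ miss_χ(x)`. Then there is a Vizing fan `(u,α),(v₁,c₁),…,(v_k,c_k)` with `v₁ = v`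
and `cᵢ = clr vᵢ`, i.e. a nonempty duplicate-free list `v₁,…,v_k` of neighbours of `u` with
`χ(u,v₁) = ⊥`, `χ(u,vᵢ) = c_{i-1}` for `i > 1`, and either `c_k ∈ miss_χ(u)` or
`c_k ∈ {c₁,…,c_{k-1}}`. -/
theorem vizing_fan_exists {V : Type*} [Fintype V] [DecidableEq V] (G : SimpleGraph V)
    [DecidableRel G.Adj] (Δ : ℕ) (hΔ : ∀ x : V, G.degree x ≤ Δ)
    (χ : Sym2 V → Option (Fin (Δ + 1))) (hχ : IsPartialEdgeColoring G χ)
    (u v : V) (huv : G.Adj u v) (hunc : χ s(u, v) = none)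
    (α : Fin (Δ + 1)) (hα : MissingAt G χ u α)
    (clr : V → Fin (Δ + 1)) (hclr : ∀ x : V, MissingAt G χ x (clr x)) :
    ∃ (l : List V) (hne : l ≠ []),
      l.Nodup ∧
      l.head hne = v ∧
      (∀ x ∈ l, G.Adj u x) ∧
      (∀ (i : ℕ) (h : i + 1 < l.length),
        χ s(u, l[i + 1]'h) = some (clr (l[i]'(by omega)))) ∧
      (MissingAt G χ u (clr (l.getLast hne)) ∨
        ∃ x ∈ l.dropLast, clr x = clr (l.getLast hne)) := by
  by_contra hcon
  have hext : ∀ n : ℕ, ∃ (l : List V) (hne : l ≠ []),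
      IsFanPrefix G χ clr u v l hne ∧ l.length = n + 1 := by
    intro n
    induction n with
    | zero =>
      exact ⟨[v], by simp, ⟨by simp, by simp, by simpa using huv, by simp⟩, by simp⟩
    | succ n ih =>
      obtain ⟨l, hne, hl, hlen⟩ := ih
      obtain ⟨w, hw⟩ := hl.exists_concat hunc
        (fun h => hcon ⟨l, hne, hl.nodup, hl.head_eq, hl.adj, hl.color_succ, Or.inl h⟩)
        (fun x hx h => hcon
          ⟨l, hne, hl.nodup, hl.head_eq, hl.adj, hl.color_succ, Or.inr ⟨x, hx, h⟩⟩)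
      exact ⟨l ++ [w], by simp, hw, by simp [hlen]⟩
  obtain ⟨l, hne, hl, hlen⟩ := hext (Fintype.card V)
  have := hl.nodup.length_le_card
  omega
end
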